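/- arXiv:1605.00939 — 2 statements merged into one kernel-verified Lean document; each statement's English description precedes it below -/
import Mathlib

section
/- Let 0 < m < n be integers and let μ be a Radon measure on ℝⁿ. Assume ℝⁿ is countably (μ,m) rectifiable, μ(ℝⁿ) < ∞, and there exists M ∈ (0,∞) such that μ(B̄(x,r)) < M·ω_m·r^m for all x ∈ spt μ and all r > 0. Then K_{μ,2}^0(x,∞) < ∞ for μ-almost all x ∈ ℝⁿ. -/
open MeasureTheory Metric Set
open scoped ENNReal NNReal

noncomputable section

/-- Euclidean space ℝⁿ. -/
abbrev Euc (n : ℕ) : Type := EuclideanSpace ℝ (Fin n)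

/-- `A(n,m)`: the set of `m`-dimensional affine planes in ℝⁿ. -/
def affPlanes (n m : ℕ) : Set (AffineSubspace ℝ (Euc n)) :=
  {L | (L : Set (Euc n)).Nonempty ∧ Module.finrank ℝ L.direction = m}

/-- `β_{μ,p}(x,r,L) = r⁻¹ (r^{-m} ∫_{B̄(x,r)} dist(y,L)^p dμ(y))^{1/p}`. -/
def betaL {n : ℕ} (μ : Measure (Euc n)) (m : ℕ) (p : ℝ) (x : Euc n) (r : ℝ)
    (L : Set (Euc n)) : ℝ≥0∞ :=
  (ENNReal.ofReal r)⁻¹ *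
    ((ENNReal.ofReal r ^ m)⁻¹ *
      ∫⁻ y in closedBall x r, ENNReal.ofReal (infDist y L ^ p) ∂μ) ^ (1 / p)

/-- non-centred `β_{μ,p}(x,r)`: infimum over all `m`-planes. -/
def betaInf {n : ℕ} (μ : Measure (Euc n)) (m : ℕ) (p : ℝ) (x : Euc n) (r : ℝ) : ℝ≥0∞ :=
  ⨅ L ∈ affPlanes n m, betaL μ m p x r (L : Set (Euc n))

/-- centred `β̊_{μ,p}(x,r)`: infimum over all `m`-planes passing through `x`. -/
def betaInfC {n : ℕ} (μ : Measure (Euc n)) (m : ℕ) (p : ℝ) (x : Euc n) (r : ℝ) : ℝ≥0∞ :=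
  ⨅ L ∈ {L ∈ affPlanes n m | x ∈ L}, betaL μ m p x r (L : Set (Euc n))

/-- `ω_m`: the Lebesgue measure of the unit ball in ℝ^m. -/
def ballVol (m : ℕ) : ℝ≥0∞ := volume (closedBall (0 : Euc m) 1)

/-- `Θ^m(μ,x,r) = μ(B̄(x,r)) / (ω_m r^m)`. -/
def theta {n : ℕ} (μ : Measure (Euc n)) (m : ℕ) (x : Euc n) (r : ℝ) : ℝ≥0∞ :=
  μ (closedBall x r) / (ballVol m * ENNReal.ofReal r ^ m)

/-- `h_min(x₀,…,x_{m+1})`: minimal height of a simplex. -/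
def hmin {n m : ℕ} (x : Fin (m + 2) → Euc n) : ℝ :=
  ⨅ j, infDist (x j) (affineSpan ℝ (Set.range x \ {x j}) : Set (Euc n))

/-- `K_{μ,p}^α(x,R)`, with `R ∈ (0,∞]` an extended real. -/
def Kcurv {n : ℕ} (μ : Measure (Euc n)) (m : ℕ) (p α : ℝ) (x : Euc n) (R : ℝ≥0∞) : ℝ≥0∞ :=
  ∫⁻ z in Set.univ.pi (fun _ : Fin (m + 1) => EMetric.closedBall x R),
    ENNReal.ofReal
      (hmin (Fin.cons x z) ^ p /
        Metric.diam (Set.range (Fin.cons x z)) ^ ((m * (m + 1) : ℝ) + (1 + α) * p))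
    ∂(Measure.pi fun _ : Fin (m + 1) => μ)

/-- The interval `(0, c)` of real numbers, with extended-real right endpoint. -/
def IooE (c : ℝ≥0∞) : Set ℝ := {r : ℝ | 0 < r ∧ ENNReal.ofReal r < c}

/-- `U(x,y) = {(z₁,…,z_m) : |z_j − x| ≤ |y − x|}`. -/
def Uset {n : ℕ} (m : ℕ) (x y : Euc n) : Set (Fin m → Euc n) :=
  {z | ∀ j, dist (z j) x ≤ dist y x}

/-- `E(x,y)`. -/
def Ecurv {n : ℕ} (μ : Measure (Euc n)) (m : ℕ) (p α : ℝ) (x y : Euc n) : ℝ≥0∞ :=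
  ∫⁻ z in Uset m x y,
    ENNReal.ofReal
      (hmin (Fin.cons x (Fin.cons y z)) ^ p /
        Metric.diam (Set.range (Fin.cons x (Fin.cons y z))) ^
          ((m * (m + 1) : ℝ) + (1 + α) * p))
    ∂(Measure.pi fun _ : Fin m => μ)

/-- The half-open cube with centre `c` and side length `l`. -/
def cube {n : ℕ} (c : Fin n → ℝ) (l : ℝ) : Set (Euc n) :=
  {y | ∀ i, y i ∈ Set.Ico (c i - l / 2) (c i + l / 2)}

/-- `β_{μ,p}(Q,L)` for a cube `Q` with side length `l`. -/
def betaQL {n : ℕ} (μ : Measure (Euc n)) (m : ℕ) (p : ℝ) (Q : Set (Euc n)) (l : ℝ)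
    (L : Set (Euc n)) : ℝ≥0∞ :=
  (ENNReal.ofReal l)⁻¹ *
    ((ENNReal.ofReal l ^ m)⁻¹ * ∫⁻ y in Q, ENNReal.ofReal (infDist y L ^ p) ∂μ) ^ (1 / p)

/-- `β_{μ,p}(Q)` for a cube `Q` with side length `l`. -/
def betaQInf {n : ℕ} (μ : Measure (Euc n)) (m : ℕ) (p : ℝ) (Q : Set (Euc n)) (l : ℝ) : ℝ≥0∞ :=
  ⨅ L ∈ affPlanes n m, betaQL μ m p Q l (L : Set (Euc n))

/-- The centre of the dyadic cube `2^{-k}(a + [0,1)ⁿ)`. -/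
def dyadicCenter {n : ℕ} (k : ℤ) (a : Fin n → ℤ) : Fin n → ℝ :=
  fun i => ((a i : ℝ) + 1 / 2) * 2 ^ (-k)

/-- The dyadic cube `2^{-k}(a + [0,1)ⁿ)`. -/
def dyadicCube {n : ℕ} (k : ℤ) (a : Fin n → ℤ) : Set (Euc n) :=
  cube (dyadicCenter k a) (2 ^ (-k))

/-- `S ⊆ ℝⁿ` is an m-dimensional submanifold of class C¹. -/
def IsC1Submanifold {n : ℕ} (m : ℕ) (S : Set (Euc n)) : Prop :=
  ∀ x ∈ S, ∃ (U : Set (Euc n)) (V : Set (Euc m)) (f : Euc m → Euc n),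
    IsOpen U ∧ x ∈ U ∧ IsOpen V ∧ ContDiffOn ℝ 1 f V ∧ InjOn f V ∧
    f '' V = S ∩ U ∧ ∀ y ∈ V, Function.Injective (fderivWithin ℝ f V y)

/-- The support of a measure: points all of whose neighbourhoods have positive measure. -/
def sptMeasure {n : ℕ} (μ : Measure (Euc n)) : Set (Euc n) :=
  {x | ∀ ε : ℝ, 0 < ε → 0 < μ (ball x ε)}

/-- `κ(x₀,…,x_{m+1}) = H^{m+1}(conv{x₀,…,x_{m+1}}) / diam^{m+1}`. -/
def kappa {n m : ℕ} (x : Fin (m + 2) → Euc n) : ℝ≥0∞ :=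
  μH[(m + 1 : ℝ)] (convexHull ℝ (Set.range x)) /
    ENNReal.ofReal (Metric.diam (Set.range x) ^ (m + 1))

/-- `M_p(μ)`. -/
def Mp {n : ℕ} (μ : Measure (Euc n)) (m : ℕ) (p : ℝ) : ℝ≥0∞ :=
  ∫⁻ x : Fin (m + 2) → Euc n,
    kappa x ^ p / ENNReal.ofReal (Metric.diam (Set.range x) ^ p)
    ∂(Measure.pi fun _ : Fin (m + 2) => μ)

/-! ### Part 1: square function estimates for translates -/

namespace RectK

lemma enorm_sq_add_le {V : Type*} [SeminormedAddCommGroup V] (a b : V) :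
    ‖a + b‖ₑ ^ 2 ≤ 2 * ‖a‖ₑ ^ 2 + 2 * ‖b‖ₑ ^ 2 := by
  have h : ‖a + b‖₊ ^ 2 ≤ 2 * ‖a‖₊ ^ 2 + 2 * ‖b‖₊ ^ 2 := by
    have h1 : ‖a + b‖₊ ≤ ‖a‖₊ + ‖b‖₊ := nnnorm_add_le a b
    have h2 : (‖a‖₊ + ‖b‖₊) ^ 2 ≤ 2 * (‖a‖₊ ^ 2 + ‖b‖₊ ^ 2) := add_sq_le
    calc ‖a + b‖₊ ^ 2 ≤ (‖a‖₊ + ‖b‖₊) ^ 2 := by gcongr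
      _ ≤ _ := h2
      _ = _ := by ring
  rw [enorm_eq_nnnorm, enorm_eq_nnnorm, enorm_eq_nnnorm]
  exact_mod_cast h

lemma enorm_sq_sub_le {V : Type*} [SeminormedAddCommGroup V] (a b : V) :
    ‖a - b‖ₑ ^ 2 ≤ 2 * ‖a‖ₑ ^ 2 + 2 * ‖b‖ₑ ^ 2 := by
  have := enorm_sq_add_le a (-b)
  rwa [enorm_neg, ← sub_eq_add_neg] at this

/-- squared `L²` norm -/
def Isq {m n : ℕ} (φ : Euc m → Euc n) : ℝ≥0∞ := ∫⁻ x, ‖φ x‖ₑ ^ 2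

variable {m n : ℕ}

lemma Isq_shift (φ : Euc m → Euc n) (w : Euc m) : Isq (fun x => φ (x + w)) = Isq φ := by
  unfold Isq
  exact lintegral_add_right_eq_self (fun x => ‖φ x‖ₑ ^ 2) w

lemma Isq_add_le (φ ψ : Euc m → Euc n) (hφ : Continuous φ) :
    Isq (fun x => φ x + ψ x) ≤ 2 * Isq φ + 2 * Isq ψ := by
  unfold Isq
  calc ∫⁻ x, ‖φ x + ψ x‖ₑ ^ 2 ≤ ∫⁻ x, (2 * ‖φ x‖ₑ ^ 2 + 2 * ‖ψ x‖ₑ ^ 2) :=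
        lintegral_mono fun x => enorm_sq_add_le _ _
    _ = _ := by
        rw [lintegral_add_left (by fun_prop), lintegral_const_mul' _ _ (by simp),
          lintegral_const_mul' _ _ (by simp)]

lemma Isq_smul (c : ℝ) (φ : Euc m → Euc n) : Isq (fun x => c • φ x) = ‖c‖ₑ ^ 2 * Isq φ := by
  unfold Isq
  simp_rw [enorm_smul, mul_pow]
  rw [lintegral_const_mul' _ _ (by simp)]

lemma Isq_smul_le (c : ℝ) (hc : |c| ≤ 1) (φ : Euc m → Euc n) :
    Isq (fun x => c • φ x) ≤ Isq φ := by
  rw [Isq_smul]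
  have : ‖c‖ₑ ≤ 1 := by
    rw [enorm_eq_nnnorm]
    have : ‖c‖₊ ≤ 1 := by rw [← NNReal.coe_le_coe]; simpa using hc
    exact_mod_cast this
  calc _ ≤ 1 ^ 2 * Isq φ := by gcongr
    _ = _ := by simp

/-- second difference -/
def D2 (F : Euc m → Euc n) (w : Euc m) : Euc m → Euc n :=
  fun x => F (x + w + w) - (2 : ℝ) • F (x + w) + F x

/-- first difference -/
def D1 (F : Euc m → Euc n) (w : Euc m) : Euc m → Euc n := fun x => F (x + w) - F x

lemma para_enorm (a b : Euc n) :
    ‖a + b‖ₑ ^ 2 + ‖a - b‖ₑ ^ 2 = 2 * ‖a‖ₑ ^ 2 + 2 * ‖b‖ₑ ^ 2 := by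
  have h := parallelogram_law_with_norm ℝ a b
  have h' : ‖a + b‖₊ ^ 2 + ‖a - b‖₊ ^ 2 = 2 * ‖a‖₊ ^ 2 + 2 * ‖b‖₊ ^ 2 := by
    apply NNReal.coe_injective
    push_cast
    nlinarith
  simp only [enorm_eq_nnnorm]
  exact_mod_cast h'

lemma para_Isq (F : Euc m → Euc n) (hF : Continuous F) (w : Euc m) :
    Isq (D1 F (w + w)) + Isq (D2 F w) = 4 * Isq (D1 F w) := by
  have h1 : Isq (D1 F w) = ∫⁻ x, ‖F (x + w + w) - F (x + w)‖ₑ ^ 2 := by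
    rw [← Isq_shift _ w]; rfl
  have h2 : Isq (D1 F (w + w)) + Isq (D2 F w) =
      2 * (∫⁻ x, ‖F (x + w + w) - F (x + w)‖ₑ ^ 2) + 2 * Isq (D1 F w) := by
    unfold Isq D1 D2
    rw [← lintegral_add_left (by fun_prop), ← lintegral_const_mul' _ _ (by simp),
      ← lintegral_const_mul' _ _ (by simp), ← lintegral_add_left (by fun_prop)]
    refine lintegral_congr fun x => ?_
    rw [← para_enorm]
    congr 3
    · rw [← add_assoc]; abel_nf
    · rw [two_smul]; abel_nf
  rw [h2, ← h1]; ring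

/-- the dyadic radius -/
def rr (k : ℕ) : ℝ := (1 / 2 : ℝ) ^ k

lemma rr_pos (k : ℕ) : 0 < rr k := by unfold rr; positivity
lemma rr_succ (k : ℕ) : rr k = rr (k + 1) + rr (k + 1) := by unfold rr; rw [pow_succ]; ring
lemma rr_zero : rr 0 = 1 := by simp [rr]
lemma rr_le_one (k : ℕ) : rr k ≤ 1 := by
  unfold rr; exact pow_le_one₀ (by norm_num) (by norm_num)

lemma four_rr (k : ℕ) : (4 : ℝ≥0∞) ^ k * ‖rr k‖ₑ ^ 2 = 1 := by
  rw [Real.enorm_eq_ofReal (rr_pos k).le, ← ENNReal.ofReal_pow (rr_pos k).le]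
  have : (4 : ℝ≥0∞) = ENNReal.ofReal 4 := by simp
  rw [this, ← ENNReal.ofReal_pow (by norm_num), ← ENNReal.ofReal_mul (by positivity)]
  have : (4 : ℝ) ^ k * rr k ^ 2 = 1 := by
    unfold rr
    rw [← pow_mul, mul_comm k 2, pow_mul, ← mul_pow]; norm_num
  rw [this]; simp

/-- Hypothesis: first differences are Lipschitz in `L²`. -/
def H1 (F : Euc m → Euc n) (A : ℝ≥0∞) : Prop := ∀ w, Isq (D1 F w) ≤ A * ‖w‖ₑ ^ 2

lemma first_le {F : Euc m → Euc n} {A : ℝ≥0∞} (hA : H1 F A) (v : Euc m) (k : ℕ) :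
    4 ^ k * Isq (D1 F (rr k • v)) ≤ A * ‖v‖ₑ ^ 2 := by
  calc _ ≤ 4 ^ k * (A * ‖rr k • v‖ₑ ^ 2) := by gcongr; exact hA _
    _ = (4 ^ k * ‖rr k‖ₑ ^ 2) * (A * ‖v‖ₑ ^ 2) := by rw [enorm_smul]; ring
    _ = _ := by rw [four_rr, one_mul]

lemma sum_D2 {F : Euc m → Euc n} (hF : Continuous F) {A : ℝ≥0∞} (hA : H1 F A)
    (v : Euc m) : ∑' k, 4 ^ k * Isq (D2 F (rr k • v)) ≤ 4 * A * ‖v‖ₑ ^ 2 := by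
  have key : ∀ N : ℕ, ∑ k ∈ Finset.range (N + 1), 4 ^ k * Isq (D2 F (rr k • v)) ≤
      4 * (4 ^ N * Isq (D1 F (rr N • v))) := by
    intro N
    induction N with
    | zero =>
      have := para_Isq F hF (rr 0 • v)
      simp only [zero_add, Finset.sum_range_one, pow_zero, one_mul]
      rw [← this]; exact le_add_self
    | succ N ih =>
      rw [Finset.sum_range_succ]
      have := para_Isq F hF (rr (N + 1) • v)
      rw [← add_smul, ← rr_succ] at this
      calc _ ≤ 4 * (4 ^ N * Isq (D1 F (rr N • v))) +
            4 ^ (N + 1) * Isq (D2 F (rr (N + 1) • v)) := by gcongr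
        _ = 4 ^ (N + 1) * (Isq (D1 F (rr N • v)) + Isq (D2 F (rr (N + 1) • v))) := by ring
        _ = _ := by rw [this]; ring
  refine ENNReal.tsum_le_of_sum_range_le fun N => ?_
  rcases N with _ | N
  · simp
  · refine (key N).trans ?_
    rw [mul_assoc]
    exact mul_le_mul_right (first_le hA v N) 4

lemma sum_mixed {F : Euc m → Euc n} (hF : Continuous F) {A : ℝ≥0∞} (hA : H1 F A)
    (v w : Euc m) :
    ∑' k, 4 ^ k * Isq (fun x => F (x + rr k • (w + v)) - F (x + rr k • w) - F (x + rr k • v) + F x)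
      ≤ 16 * A * (‖v‖ₑ + ‖w‖ₑ) ^ 2 := by
  set p : Euc m := (1 / 2 : ℝ) • (w + v)
  set q : Euc m := (1 / 2 : ℝ) • (w - v)
  have hp : ‖p‖ₑ ≤ ‖v‖ₑ + ‖w‖ₑ := by
    have : ‖(1 / 2 : ℝ)‖ₑ ≤ 1 := by
      rw [Real.enorm_eq_ofReal (by norm_num)]; simp
    calc ‖p‖ₑ = ‖(1 / 2 : ℝ)‖ₑ * ‖w + v‖ₑ := enorm_smul _ _
      _ ≤ 1 * (‖w‖ₑ + ‖v‖ₑ) := by gcongr; exact enorm_add_le _ _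
      _ = _ := by rw [one_mul, add_comm]
  have hq : ‖q‖ₑ ≤ ‖v‖ₑ + ‖w‖ₑ := by
    have : ‖(1 / 2 : ℝ)‖ₑ ≤ 1 := by
      rw [Real.enorm_eq_ofReal (by norm_num)]; simp
    calc ‖q‖ₑ = ‖(1 / 2 : ℝ)‖ₑ * ‖w - v‖ₑ := enorm_smul _ _
      _ ≤ 1 * (‖w‖ₑ + ‖v‖ₑ) := by gcongr; exact enorm_sub_le
      _ = _ := by rw [one_mul, add_comm]
  have hk : ∀ k, Isq (fun x => F (x + rr k • (w + v)) - F (x + rr k • w) - F (x + rr k • v) + F x)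
      ≤ 2 * Isq (D2 F (rr k • p)) + 2 * Isq (D2 F (rr k • q)) := by
    intro k
    have e : (fun x => F (x + rr k • (w + v)) - F (x + rr k • w) - F (x + rr k • v) + F x) =
        fun x => D2 F (rr k • p) x + (-1 : ℝ) • D2 F (rr k • q) (x + rr k • v) := by
      ext1 x
      have e1 : x + rr k • p + rr k • p = x + rr k • (w + v) := by simp only [p]; module
      have e2 : x + rr k • p + rr k • q = x + rr k • w := by simp only [p, q]; module
      have e3 : x + rr k • v + rr k • q = x + rr k • p := by simp only [p, q]; module
      simp only [D2, e1, e2, e3]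
      module
    rw [e]
    refine (Isq_add_le _ _ (by unfold D2; fun_prop)).trans ?_
    gcongr
    refine (Isq_smul_le _ (by simp) _).trans ?_
    rw [Isq_shift (D2 F (rr k • q))]
  calc _ ≤ ∑' k, (2 * (4 ^ k * Isq (D2 F (rr k • p))) + 2 * (4 ^ k * Isq (D2 F (rr k • q)))) := by
        refine ENNReal.tsum_le_tsum fun k => ?_
        calc _ ≤ 4 ^ k * (2 * Isq (D2 F (rr k • p)) + 2 * Isq (D2 F (rr k • q))) := by
              gcongr; exact hk k
          _ = _ := by ring
    _ = 2 * (∑' k, 4 ^ k * Isq (D2 F (rr k • p))) + 2 * ∑' k, 4 ^ k * Isq (D2 F (rr k • q)) := by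
        rw [ENNReal.tsum_add, ENNReal.tsum_mul_left, ENNReal.tsum_mul_left]
    _ ≤ 2 * (4 * A * ‖p‖ₑ ^ 2) + 2 * (4 * A * ‖q‖ₑ ^ 2) := by
        gcongr <;> exact sum_D2 hF hA _
    _ ≤ 2 * (4 * A * (‖v‖ₑ + ‖w‖ₑ) ^ 2) + 2 * (4 * A * (‖v‖ₑ + ‖w‖ₑ) ^ 2) := by gcongr
    _ = _ := by ring

lemma seq_lemma (b d : ℕ → ℝ≥0∞) (C : ℝ≥0∞) (hC : C ≠ ∞) (hb : ∀ k, b k ≤ C)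
    (h : ∀ k, 2 * b k ≤ b (k + 1) + d (k + 1)) : ∑' k, b k ≤ C + ∑' k, d k := by
  refine ENNReal.tsum_le_of_sum_range_le fun N => ?_
  set S := ∑ k ∈ Finset.range N, b k
  have hS : S ≠ ∞ := by
    refine (ENNReal.sum_lt_top.2 fun k _ => (hb k).trans_lt hC.lt_top).ne
  have h1 : S + S ≤ S + (C + ∑' k, d k) := by
    calc S + S = ∑ k ∈ Finset.range N, 2 * b k := by rw [← Finset.mul_sum, two_mul]
      _ ≤ ∑ k ∈ Finset.range N, (b (k + 1) + d (k + 1)) := Finset.sum_le_sum fun k _ => h k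
      _ = ∑ k ∈ Finset.range N, b (k + 1) + ∑ k ∈ Finset.range N, d (k + 1) :=
          Finset.sum_add_distrib
      _ ≤ (S + C) + ∑' k, d k := by
          gcongr
          · calc _ ≤ ∑ k ∈ Finset.range N, b (k + 1) + b 0 := le_self_add
              _ = S + b N := by rw [← Finset.sum_range_succ', Finset.sum_range_succ]
              _ ≤ _ := by gcongr; exact hb N
          · calc _ ≤ ∑ k ∈ Finset.range N, d (k + 1) + d 0 := le_self_add
              _ = ∑ k ∈ Finset.range (N + 1), d k := by rw [← Finset.sum_range_succ']
              _ ≤ _ := ENNReal.sum_le_tsum _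
      _ = _ := by ring
  exact (ENNReal.add_le_add_iff_left hS).1 h1

/-- one-dimensional interpolation error -/
def Int1 (F : Euc m → Euc n) (w : Euc m) (t : ℝ) : Euc m → Euc n :=
  fun x => F (x + t • w) - F x - t • (F (x + w) - F x)

lemma Int1_rec {F : Euc m → Euc n} (hF : Continuous F) (w : Euc m) (t : ℝ) (ht : t ∈ Icc (0:ℝ) 1) :
    ∃ t' ∈ Icc (0:ℝ) 1, Isq (Int1 F (w + w) t) ≤ 2 * Isq (Int1 F w t') + 2 * Isq (D2 F w) := by
  obtain ⟨h0, h1⟩ := ht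
  rcases le_total t (1 / 2) with h | h
  · refine ⟨2 * t, ⟨by linarith, by linarith⟩, ?_⟩
    have e : Int1 F (w + w) t = fun x => Int1 F w (2 * t) x + (-t) • D2 F w x := by
      ext1 x
      have e1 : x + t • (w + w) = x + (2 * t) • w := by module
      have e2 : x + (w + w) = x + w + w := by abel
      simp only [Int1, D2, e1, e2]
      module
    rw [e]
    refine (Isq_add_le _ _ (by unfold Int1; fun_prop)).trans ?_
    gcongr
    exact Isq_smul_le _ (by rw [abs_neg, abs_of_nonneg h0]; exact h1) _
  · refine ⟨2 * t - 1, ⟨by linarith, by linarith⟩, ?_⟩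
    have e : Int1 F (w + w) t = fun x => Int1 F w (2 * t - 1) (x + w) + (t - 1) • D2 F w x := by
      ext1 x
      have e1 : x + w + (2 * t - 1) • w = x + t • (w + w) := by module
      have e2 : x + (w + w) = x + w + w := by abel
      simp only [Int1, D2, e1, e2]
      module
    rw [e]
    refine (Isq_add_le _ _ (by unfold Int1; fun_prop)).trans ?_
    rw [Isq_shift (Int1 F w (2 * t - 1))]
    gcongr
    exact Isq_smul_le _ (by rw [abs_le]; constructor <;> linarith) _

lemma sum_Int1 {F : Euc m → Euc n} (hF : Continuous F) {A : ℝ≥0∞} (hAt : A ≠ ∞) (hA : H1 F A)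
    (v : Euc m) (t : ℝ) (ht : t ∈ Icc (0:ℝ) 1) :
    ∑' k, 4 ^ k * Isq (Int1 F (rr k • v) t) ≤ 8 * A * ‖v‖ₑ ^ 2 := by
  set b : ℕ → ℝ≥0∞ := fun k => ⨆ t ∈ Icc (0:ℝ) 1, 4 ^ k * Isq (Int1 F (rr k • v) t)
  set d : ℕ → ℝ≥0∞ := fun k => 4 ^ k * Isq (D2 F (rr k • v))
  have hb : ∀ k, b k ≤ 4 * A * ‖v‖ₑ ^ 2 := by
    intro k
    refine iSup₂_le fun t ht => ?_
    have htn : ‖t‖ₑ ≤ 1 := by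
      rw [Real.enorm_eq_ofReal ht.1]; simpa using ht.2
    have e : Int1 F (rr k • v) t = fun x => D1 F (rr k • (t • v)) x + (-t) • D1 F (rr k • v) x := by
      ext1 x
      have : x + t • rr k • v = x + rr k • t • v := by module
      simp only [Int1, D1, this]; module
    have hD : Continuous (D1 F (rr k • (t • v))) := by unfold D1; fun_prop
    calc _ ≤ 4 ^ k * (2 * Isq (D1 F (rr k • (t • v))) + 2 * Isq (D1 F (rr k • v))) := by
          gcongr
          rw [e]
          refine (Isq_add_le _ _ hD).trans ?_
          gcongr
          exact Isq_smul_le _ (by rw [abs_neg, abs_of_nonneg ht.1]; exact ht.2) _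
      _ = 2 * (4 ^ k * Isq (D1 F (rr k • (t • v)))) + 2 * (4 ^ k * Isq (D1 F (rr k • v))) := by ring
      _ ≤ 2 * (A * ‖t • v‖ₑ ^ 2) + 2 * (A * ‖v‖ₑ ^ 2) := by
          exact add_le_add (mul_le_mul_right (first_le hA _ k) 2) (mul_le_mul_right (first_le hA _ k) 2)
      _ ≤ 2 * (A * (1 * ‖v‖ₑ) ^ 2) + 2 * (A * ‖v‖ₑ ^ 2) := by
          rw [enorm_smul]; gcongr
      _ = _ := by ring
  have hrec : ∀ k, 2 * b k ≤ b (k + 1) + d (k + 1) := by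
    intro k
    simp only [b, ENNReal.mul_iSup]
    refine iSup₂_le fun t ht => ?_
    obtain ⟨t', ht', h⟩ := Int1_rec hF (rr (k + 1) • v) t ht
    rw [← add_smul, ← rr_succ] at h
    calc 2 * (4 ^ k * Isq (Int1 F (rr k • v) t))
        ≤ 2 * (4 ^ k * (2 * Isq (Int1 F (rr (k + 1) • v) t') + 2 * Isq (D2 F (rr (k + 1) • v)))) := by
          gcongr
      _ = 4 ^ (k + 1) * Isq (Int1 F (rr (k + 1) • v) t') + d (k + 1) := by
          simp only [d]; ring
      _ ≤ _ := by
          gcongr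
          exact le_iSup₂ (f := fun t (_ : t ∈ Icc (0:ℝ) 1) =>
            4 ^ (k + 1) * Isq (Int1 F (rr (k + 1) • v) t)) t' ht'
  have hfin : 4 * A * ‖v‖ₑ ^ 2 ≠ ∞ := by
    refine ENNReal.mul_ne_top (ENNReal.mul_ne_top (by simp) hAt) (by simp)
  calc _ ≤ ∑' k, b k := ENNReal.tsum_le_tsum fun k =>
        le_iSup₂ (f := fun t (_ : t ∈ Icc (0:ℝ) 1) => 4 ^ k * Isq (Int1 F (rr k • v) t)) t ht
    _ ≤ 4 * A * ‖v‖ₑ ^ 2 + ∑' k, d k := seq_lemma b d _ hfin hb hrec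
    _ ≤ 4 * A * ‖v‖ₑ ^ 2 + 4 * A * ‖v‖ₑ ^ 2 := by gcongr; exact sum_D2 hF hA v
    _ = _ := by ring

/-- multi-dimensional interpolation error -/
def IntS {ι : Type*} (F : Euc m → Euc n) (s : Finset ι) (r : ℝ) (v : ι → Euc m) (h : ι → ℝ) :
    Euc m → Euc n :=
  fun x => F (x + r • ∑ i ∈ s, h i • v i) - F x - ∑ i ∈ s, h i • (F (x + r • v i) - F x)

lemma sum_IntS {ι : Type*} [DecidableEq ι] {F : Euc m → Euc n} (hF : Continuous F) {A : ℝ≥0∞}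
    (hAt : A ≠ ∞) (hA : H1 F A) (v : ι → Euc m) (s : Finset ι) :
    ∃ C : ℝ≥0∞, C ≠ ∞ ∧ ∀ h : ι → ℝ, (∀ i, h i ∈ Icc (0:ℝ) 1) →
      ∑' k, 4 ^ k * Isq (IntS F s (rr k) v h) ≤ C := by
  induction s using Finset.induction_on with
  | empty =>
    refine ⟨0, by simp, fun h _ => ?_⟩
    simp [IntS, Isq]
  | insert j s hj ih =>
    obtain ⟨C, hC, ih⟩ := ih
    set W : ℝ≥0∞ := ‖v j‖ₑ + ∑ i ∈ s, ‖v i‖ₑ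
    refine ⟨4 * C + 4 * (16 * A * W ^ 2) + 2 * (8 * A * ‖v j‖ₑ ^ 2), ?_, fun h hh => ?_⟩
    · have hW : W ≠ ∞ := by
        simp only [W, ne_eq, ENNReal.add_eq_top, enorm_ne_top, false_or]
        exact (ENNReal.sum_lt_top.2 fun i _ => by simp).ne
      finiteness
    have hn : ∀ i, ‖h i • v i‖ₑ ≤ ‖v i‖ₑ := by
      intro i
      have : ‖h i‖ₑ ≤ 1 := by rw [Real.enorm_eq_ofReal (hh i).1]; simpa using (hh i).2
      rw [enorm_smul]
      calc _ ≤ 1 * ‖v i‖ₑ := by gcongr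
        _ = _ := one_mul _
    set w : Euc m := ∑ i ∈ s, h i • v i with hw
    set mix : ℕ → Euc m → Euc n := fun k x => F (x + rr k • (w + h j • v j)) - F (x + rr k • w)
      - F (x + rr k • (h j • v j)) + F x with hmix
    have hI : ∀ k, Isq (IntS F (insert j s) (rr k) v h) ≤ 4 * Isq (IntS F s (rr k) v h) +
        4 * Isq (mix k) + 2 * Isq (Int1 F (rr k • v j) (h j)) := by
      intro k
      have e : IntS F (insert j s) (rr k) v h =
          fun x => (IntS F s (rr k) v h x + mix k x) + Int1 F (rr k • v j) (h j) x := by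
        ext1 x
        have e1 : x + h j • rr k • v j = x + rr k • h j • v j := by module
        simp only [IntS, Int1, hmix, Finset.sum_insert hj, ← hw, e1]
        rw [add_comm (h j • v j) w]
        abel
      have c1 : Continuous (IntS F s (rr k) v h) := by unfold IntS; fun_prop
      have c2 : Continuous (mix k) := by simp only [hmix]; fun_prop
      rw [e]
      calc _ ≤ 2 * Isq (fun x => IntS F s (rr k) v h x + mix k x) +
            2 * Isq (Int1 F (rr k • v j) (h j)) := Isq_add_le _ _ (by fun_prop)
        _ ≤ 2 * (2 * Isq (IntS F s (rr k) v h) + 2 * Isq (mix k)) +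
            2 * Isq (Int1 F (rr k • v j) (h j)) := by
            gcongr; exact Isq_add_le _ _ c1
        _ = _ := by ring
    calc _ ≤ ∑' k, (4 * (4 ^ k * Isq (IntS F s (rr k) v h)) + 4 * (4 ^ k * Isq (mix k)) +
          2 * (4 ^ k * Isq (Int1 F (rr k • v j) (h j)))) := by
          refine ENNReal.tsum_le_tsum fun k => ?_
          calc _ ≤ 4 ^ k * (4 * Isq (IntS F s (rr k) v h) +
                4 * Isq (mix k) + 2 * Isq (Int1 F (rr k • v j) (h j))) := by gcongr; exact hI k
            _ = _ := by ring
      _ = 4 * (∑' k, 4 ^ k * Isq (IntS F s (rr k) v h)) + 4 * (∑' k, 4 ^ k * Isq (mix k)) +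
          2 * (∑' k, 4 ^ k * Isq (Int1 F (rr k • v j) (h j))) := by
          rw [ENNReal.tsum_add, ENNReal.tsum_add, ENNReal.tsum_mul_left, ENNReal.tsum_mul_left,
            ENNReal.tsum_mul_left]
      _ ≤ _ := by
          gcongr
          · exact ih h hh
          · refine (sum_mixed hF hA (h j • v j) w).trans ?_
            gcongr
            refine add_le_add (hn j) ?_
            refine (enorm_sum_le _ _).trans (Finset.sum_le_sum fun i _ => hn i)
          · exact sum_Int1 hF hAt hA (v j) (h j) (hh j)

end RectK
/-! ### Part 2: affine approximation of Lipschitz maps with compact support -/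

namespace RectK

variable {m n : ℕ}

lemma H1_of_lipschitz {F : Euc m → Euc n} {K : ℝ≥0} (hK : LipschitzWith K F)
    (hc : HasCompactSupport F) : ∃ A : ℝ≥0∞, A ≠ ∞ ∧ H1 F A := by
  have hcont := hK.continuous
  set T := tsupport F
  have hT : volume T ≠ ∞ := hc.isCompact.measure_lt_top.ne
  have hTm : MeasurableSet T := (isClosed_tsupport F).measurableSet
  refine ⟨(K : ℝ≥0∞) ^ 2 * (2 * volume T), by finiteness, fun w => ?_⟩
  have hpt : ∀ x, ‖D1 F w x‖ₑ ^ 2 ≤ (K : ℝ≥0∞) ^ 2 * ‖w‖ₑ ^ 2 *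
      (T.indicator 1 x + T.indicator 1 (x + w)) := by
    intro x
    by_cases hx : x ∈ T ∨ x + w ∈ T
    · have h1 : (1 : ℝ≥0∞) ≤ T.indicator 1 x + T.indicator 1 (x + w) := by
        rcases hx with hx | hx
        · simp [hx]
        · simp [hx]
      have h2 : ‖D1 F w x‖ₑ ≤ K * ‖w‖ₑ := by
        have := hK (x + w) x
        rw [edist_eq_enorm_sub, edist_eq_enorm_sub] at this
        simpa [D1] using this
      calc ‖D1 F w x‖ₑ ^ 2 ≤ (K * ‖w‖ₑ) ^ 2 * 1 := by rw [mul_one]; gcongr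
        _ ≤ (K * ‖w‖ₑ) ^ 2 * (T.indicator 1 x + T.indicator 1 (x + w)) := by gcongr
        _ = _ := by rw [mul_pow]
    · push Not at hx
      have : D1 F w x = 0 := by
        simp [D1, image_eq_zero_of_notMem_tsupport hx.1, image_eq_zero_of_notMem_tsupport hx.2]
      simp [this]
  calc Isq (D1 F w) ≤ ∫⁻ x, (K : ℝ≥0∞) ^ 2 * ‖w‖ₑ ^ 2 *
      (T.indicator 1 x + T.indicator 1 (x + w)) := lintegral_mono hpt
    _ = (K : ℝ≥0∞) ^ 2 * ‖w‖ₑ ^ 2 * (volume T + volume T) := by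
        rw [lintegral_const_mul' _ _ (by finiteness), lintegral_add_left
          ((measurable_one.indicator hTm)),
          lintegral_add_right_eq_self (fun x => T.indicator (1 : Euc m → ℝ≥0∞) x) w,
          lintegral_indicator_one hTm]
    _ = _ := by ring

/-- Dorronsoro-type theorem: affine approximations. -/
lemma dorronsoro {F : Euc m → Euc n} {K : ℝ≥0} (hK : LipschitzWith K F)
    (hc : HasCompactSupport F) (R : ℝ) (hR : 0 < R) :
    ∃ (a : ℕ → Euc m → Euc n) (l : ℕ → Euc m → Euc m → Euc n) (K' : ℝ≥0) (C : ℝ≥0∞),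
      C ≠ ∞ ∧
      (∀ k, Continuous (fun p : Euc m × Euc m => a k p.1 + l k p.1 p.2)) ∧
      (∀ k x, IsLinearMap ℝ (l k x)) ∧
      (∀ k x h, ‖l k x h‖ ≤ K' * rr k * ‖h‖) ∧
      (∀ h ∈ closedBall (0 : Euc m) R,
        ∑' k, 4 ^ k * ∫⁻ x, ‖F (x + rr k • h) - (a k x + l k x h)‖ₑ ^ 2 ≤ C) := by
  have hcont := hK.continuous
  obtain ⟨A, hAt, hA⟩ := H1_of_lipschitz hK hc
  set v : Fin m → Euc m := fun i => (2 * R) • EuclideanSpace.single i (1 : ℝ) with hv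
  obtain ⟨C, hC, hS⟩ := sum_IntS hcont hAt hA v Finset.univ
  set q : Euc m := WithLp.toLp 2 (fun _ => R) with hq
  set b : ℕ → Euc m → Euc m := fun k x => x - rr k • q with hb
  set dF : ℕ → Euc m → Fin m → Euc n := fun k x i => F (b k x + rr k • v i) - F (b k x) with hdF
  have hdn : ∀ k x i, ‖dF k x i‖ ≤ K * (rr k * (2 * R)) := by
    intro k x i
    have := hK.dist_le_mul (b k x + rr k • v i) (b k x)
    rw [dist_eq_norm, dist_eq_norm] at this
    refine this.trans (le_of_eq ?_)
    simp only [hv, add_sub_cancel_left, norm_smul]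
    simp [abs_of_pos (rr_pos k), abs_of_pos hR]
  refine ⟨fun k x => F (b k x) + ∑ i, (1 / 2 : ℝ) • dF k x i,
    fun k x h => ∑ i, (h i / (2 * R)) • dF k x i, K * m, C, hC, ?_, ?_, ?_, ?_⟩
  · intro k
    simp only [hdF, hb]
    fun_prop
  · intro k x
    constructor
    · intro y z
      simp [add_div, add_smul, Finset.sum_add_distrib]
    · intro c y
      simp [mul_div_assoc, mul_smul, Finset.smul_sum]
  · intro k x h
    calc ‖∑ i, (h i / (2 * R)) • dF k x i‖ ≤ ∑ i, ‖(h i / (2 * R)) • dF k x i‖ := norm_sum_le _ _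
      _ ≤ ∑ i : Fin m, K * rr k * ‖h‖ := by
          refine Finset.sum_le_sum fun i _ => ?_
          rw [norm_smul, norm_div, Real.norm_of_nonneg (by positivity : (0:ℝ) ≤ 2 * R)]
          have h1 : ‖h i‖ ≤ ‖h‖ := PiLp.norm_apply_le h i
          calc ‖h i‖ / (2 * R) * ‖dF k x i‖ ≤ ‖h‖ / (2 * R) * (K * (rr k * (2 * R))) := by
                gcongr; exact hdn k x i
            _ = _ := by field_simp
      _ = _ := by simp; ring
  · intro h hh
    set t : Fin m → ℝ := fun i => (h i + R) / (2 * R) with ht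
    have htm : ∀ i, t i ∈ Icc (0:ℝ) 1 := by
      intro i
      have h1 : |h i| ≤ R := by
        have := PiLp.norm_apply_le h i
        rw [Real.norm_eq_abs] at this
        exact this.trans (by simpa using hh)
      rw [abs_le] at h1
      constructor
      · simp only [ht]; apply div_nonneg <;> linarith
      · simp only [ht]; rw [div_le_one (by positivity)]; linarith
    refine (ENNReal.tsum_le_tsum fun k => ?_).trans (hS t htm)
    have e0 : ∑ i, t i • v i = h + q := by
      ext j
      simp only [hv, ht, hq, PiLp.add_apply, WithLp.ofLp_sum, Finset.sum_apply, PiLp.smul_apply]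
      rw [Finset.sum_eq_single j]
      · simp; field_simp
      · intro i _ hij
        simp [hij.symm]
      · simp
    have e : (fun x => F (x + rr k • h) - ((F (b k x) + ∑ i, (1 / 2 : ℝ) • dF k x i) +
        ∑ i, (h i / (2 * R)) • dF k x i)) =
        fun x => IntS F Finset.univ (rr k) v t (x + (-(rr k • q))) := by
      ext1 x
      have e1 : x + (-(rr k • q)) + rr k • (h + q) = x + rr k • h := by module
      have e2 : x + (-(rr k • q)) = b k x := by simp only [hb]; abel
      simp only [IntS, e0, e1]
      rw [e2]
      have e3 : ∑ i, t i • (F (b k x + rr k • v i) - F (b k x)) =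
          ∑ i, (1 / 2 : ℝ) • dF k x i + ∑ i, (h i / (2 * R)) • dF k x i := by
        rw [← Finset.sum_add_distrib]
        refine Finset.sum_congr rfl fun i _ => ?_
        rw [← add_smul]
        congr 1
        simp only [ht]; field_simp; ring
      rw [e3]; abel
    have := Isq_shift (IntS F Finset.univ (rr k) v t) (-(rr k • q))
    rw [← e] at this
    rw [← this]
    rfl

end RectK
/-! ### Part 3: bounding the curvature integral by distances to affine maps -/

namespace RectK

variable {m n : ℕ}

lemma hmin_le_infDist (x : Fin (m + 2) → Euc n) (j : Fin (m + 2)) :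
    hmin x ≤ infDist (x j) (affineSpan ℝ (Set.range x \ {x j}) : Set (Euc n)) :=
  ciInf_le (Set.finite_range _).bddBelow j

lemma hmin_nonneg (x : Fin (m + 2) → Euc n) : 0 ≤ hmin x :=
  le_ciInf fun _ => infDist_nonneg

lemma hmin_le_diam (x : Fin (m + 2) → Euc n) (hx : Function.Injective x) :
    hmin x ≤ Metric.diam (Set.range x) := by
  refine (hmin_le_infDist x 0).trans ?_
  have h1 : x 1 ∈ (affineSpan ℝ (Set.range x \ {x 0}) : Set (Euc n)) := by
    apply subset_affineSpan
    refine ⟨⟨1, rfl⟩, ?_⟩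
    intro h
    exact absurd (hx h) (by simp)
  refine (infDist_le_dist_of_mem h1).trans ?_
  exact dist_le_diam_of_mem (Set.finite_range x).isBounded ⟨0, rfl⟩ ⟨1, rfl⟩

lemma hmin_le_sum (x : Fin (m + 2) → Euc n) (hx : Function.Injective x) (c : Euc n)
    (l : Euc m → Euc n) (hl : IsLinearMap ℝ l) (q : Fin (m + 2) → Euc m) :
    hmin x ≤ ∑ i, ‖x i - (c + l (q i))‖ := by
  classical
  have hdep : ¬ LinearIndependent ℝ (fun i => ((q i, 1) : Euc m × ℝ)) := by
    intro h
    have := h.fintype_card_le_finrank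
    simp at this
  obtain ⟨g, hg, i0, hi0⟩ := Fintype.not_linearIndependent_iff.1 hdep
  have hg1 : ∑ i, g i • q i = 0 := by
    have := congrArg Prod.fst hg
    simpa [Prod.fst_sum] using this
  have hg2 : ∑ i, g i = 0 := by
    have := congrArg Prod.snd hg
    simpa [Prod.snd_sum] using this
  obtain ⟨j, -, hj⟩ := Finset.exists_max_image Finset.univ (fun i => |g i|) ⟨i0, Finset.mem_univ _⟩
  have hgj : g j ≠ 0 := by
    intro h
    have := hj i0 (Finset.mem_univ _)
    rw [h, abs_zero] at this
    exact hi0 (abs_nonpos_iff.1 this)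
  set w : Fin (m + 2) → ℝ := fun i => (if i = j then 1 else 0) - g i / g j with hw
  have hw1 : ∑ i, w i = 1 := by
    simp [hw, Finset.sum_sub_distrib, ← Finset.sum_div, hg2]
  set P : Euc n := ∑ i, w i • x i with hP
  have hPmem : P ∈ (affineSpan ℝ (Set.range x \ {x j}) : Set (Euc n)) := by
    have h := affineCombination_mem_affineSpan_image (k := ℝ) (s := Finset.univ) (w := w) hw1
      (s' := {j}ᶜ) (by
        intro i _ hi
        have : i = j := by simpa using hi
        simp [hw, this, hgj]) x
    rw [Finset.affineCombination_eq_linear_combination _ _ _ hw1] at h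
    have e : x '' {j}ᶜ = Set.range x \ {x j} := by
      rw [Set.image_compl_eq_range_sdiff_image hx, Set.image_singleton]
    rw [e] at h
    exact h
  refine (hmin_le_infDist x j).trans ((infDist_le_dist_of_mem hPmem).trans ?_)
  have hlin : ∑ i, (g i / g j) • (c + l (q i)) = 0 := by
    let L := hl.mk' l
    have h1 : ∑ i, g i • (c + l (q i)) = 0 := by
      simp only [smul_add, Finset.sum_add_distrib, ← Finset.sum_smul, hg2, zero_smul, zero_add]
      have : ∑ i, g i • L (q i) = L (∑ i, g i • q i) := by simp [map_sum]
      change ∑ i, g i • L (q i) = 0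
      rw [this, hg1, map_zero]
    have h2 : ∑ i, (g i / g j) • (c + l (q i)) = (g j)⁻¹ • ∑ i, g i • (c + l (q i)) := by
      rw [Finset.smul_sum]
      refine Finset.sum_congr rfl fun i _ => ?_
      rw [smul_smul]; congr 1; field_simp
    rw [h2, h1, smul_zero]
  have hdiff : x j - P = ∑ i, (g i / g j) • (x i - (c + l (q i))) := by
    simp only [smul_sub (g _ / g j), Finset.sum_sub_distrib, hlin, sub_zero]
    simp only [hP, hw, sub_smul, Finset.sum_sub_distrib]
    simp
  rw [dist_eq_norm, hdiff]
  refine (norm_sum_le _ _).trans (Finset.sum_le_sum fun i _ => ?_)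
  rw [norm_smul, norm_div, Real.norm_eq_abs, Real.norm_eq_abs]
  have : |g i| / |g j| ≤ 1 := by
    rw [div_le_one (abs_pos.2 hgj)]; exact hj i (Finset.mem_univ _)
  calc _ ≤ 1 * ‖x i - (c + l (q i))‖ := by gcongr
    _ = _ := one_mul _

/-- almost every tuple is injective together with `x` -/
lemma ae_injective (μ : Measure (Euc n)) [IsFiniteMeasure μ] [NullSingletonClass μ] (x : Euc n) :
    ∀ᵐ z ∂(Measure.pi fun _ : Fin (m + 1) => μ),
      Function.Injective (Fin.cons x z : Fin (m + 2) → Euc n) := by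
  have h1 : ∀ i : Fin (m + 1), ∀ᵐ z ∂(Measure.pi fun _ : Fin (m + 1) => μ), z i ≠ x := by
    intro i
    have : ∀ᵐ y ∂μ, y ≠ x := by
      rw [ae_iff]; simp
    exact (Measure.quasiMeasurePreserving_eval (fun _ : Fin (m + 1) => μ) i).ae this
  have h2 : ∀ i j : Fin (m + 1), i ≠ j →
      ∀ᵐ z ∂(Measure.pi fun _ : Fin (m + 1) => μ), z i ≠ z j := by
    intro i j hij
    obtain ⟨j', rfl⟩ := Fin.exists_succAbove_eq hij.symm
    have hmp := measurePreserving_piFinSuccAbove (fun _ : Fin (m + 1) => μ) i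
    have h0 : ∀ᵐ p ∂(μ.prod (Measure.pi fun _ : Fin m => μ)), p.1 ≠ p.2 j' := by
      rw [ae_iff]
      have hs : MeasurableSet {p : Euc n × (Fin m → Euc n) | ¬ p.1 ≠ p.2 j'} := by
        simp only [not_not]
        exact measurableSet_eq_fun (by fun_prop) (by fun_prop)
      have hs' : MeasurableSet (Prod.swap ⁻¹' {p : Euc n × (Fin m → Euc n) | ¬ p.1 ≠ p.2 j'}) :=
        measurable_swap hs
      rw [← Measure.prod_swap, Measure.map_apply measurable_swap hs,
        Measure.measure_prod_null hs']
      refine Filter.Eventually.of_forall fun w => ?_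
      simp
    exact hmp.quasiMeasurePreserving.ae h0
  have h1' := ae_all_iff.2 h1
  have h2' : ∀ᵐ z ∂(Measure.pi fun _ : Fin (m + 1) => μ), ∀ i j : Fin (m + 1), i ≠ j → z i ≠ z j := by
    refine ae_all_iff.2 fun i => ae_all_iff.2 fun j => ?_
    by_cases hij : i = j
    · simp [hij]
    · filter_upwards [h2 i j hij] with z hz _ using hz
  filter_upwards [h1', h2'] with z hz1 hz2
  rw [Fin.cons_injective_iff]
  refine ⟨?_, ?_⟩
  · rintro ⟨i, hi⟩; exact hz1 i hi
  · intro i j hij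
    by_contra h
    exact hz2 i j h hij

lemma lintegral_pi_coord (μ : Measure (Euc n)) [IsFiniteMeasure μ] (B : Set (Euc n))
    (φ : Euc n → ℝ≥0∞) (hφ : Measurable φ) (i : Fin (m + 1)) :
    ∫⁻ z in Set.univ.pi (fun _ : Fin (m + 1) => B), φ (z i) ∂(Measure.pi fun _ : Fin (m + 1) => μ)
      = μ B ^ m * ∫⁻ y in B, φ y ∂μ := by
  classical
  rw [Measure.restrict_pi_pi]
  have h : Measure.map (fun z : Fin (m + 1) → Euc n => z i)
      (Measure.pi fun _ : Fin (m + 1) => μ.restrict B) = _ :=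
    Measure.pi_map_eval (μ := fun _ : Fin (m + 1) => μ.restrict B) i
  rw [← lintegral_map (f := φ) (g := fun z : Fin (m + 1) → Euc n => z i) hφ (by fun_prop)]
  rw [h, lintegral_smul_measure]
  simp [Finset.card_erase_of_mem]

end RectK
/-! ### Part 4: the bound of the curvature integral -/

namespace RectK

variable {m n : ℕ}

lemma two_rr (k : ℕ) : (2 : ℝ≥0∞) ^ k * ENNReal.ofReal (rr k) = 1 := by
  have h : (2 : ℝ≥0∞) ^ k = ENNReal.ofReal (2 ^ k) := by
    rw [ENNReal.ofReal_pow (by norm_num)]; simp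
  rw [h, ← ENNReal.ofReal_mul (by positivity), rr, ← mul_pow]
  norm_num

lemma exists_rr {ρ : ℝ} (h0 : 0 < ρ) (h1 : ρ ≤ 1) : ∃ k, rr (k + 1) < ρ ∧ ρ ≤ rr k := by
  obtain ⟨k, hk⟩ := exists_nat_pow_near_of_lt_one h0 h1 (by norm_num : (0:ℝ) < 1 / 2) (by norm_num)
  exact ⟨k, hk⟩

lemma hmin_sq_le (x : Fin (m + 2) → Euc n) (hx : Function.Injective x) (c : Euc n)
    (l : Euc m → Euc n) (hl : IsLinearMap ℝ l) (q : Fin (m + 2) → Euc m) :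
    ENNReal.ofReal (hmin x ^ 2) ≤ (m + 2 : ℕ) * ∑ i, ‖x i - (c + l (q i))‖ₑ ^ 2 := by
  have h1 := hmin_le_sum x hx c l hl q
  have h2 : hmin x ^ 2 ≤ (m + 2 : ℕ) * ∑ i, ‖x i - (c + l (q i))‖ ^ 2 := by
    refine (pow_le_pow_left₀ (hmin_nonneg x) h1 2).trans ?_
    have := sq_sum_le_card_mul_sum_sq (s := Finset.univ) (f := fun i => ‖x i - (c + l (q i))‖)
    simpa using this
  refine (ENNReal.ofReal_le_ofReal h2).trans ?_
  rw [ENNReal.ofReal_mul (by positivity), ENNReal.ofReal_sum_of_nonneg (by intros; positivity)]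
  simp only [ENNReal.ofReal_pow (norm_nonneg _), ofReal_norm, ENNReal.ofReal_natCast]
  exact le_rfl

/-- the pointwise bound on the integrand -/
lemma integrand_le (x : Euc n) (z : Fin (m + 1) → Euc n)
    (hz : Function.Injective (Fin.cons x z : Fin (m + 2) → Euc n))
    (a : ℕ → Euc n) (l : ℕ → Euc m → Euc n) (hl : ∀ k, IsLinearMap ℝ (l k))
    (q : ℕ → Euc n → Euc m) :
    ENNReal.ofReal (hmin (Fin.cons x z) ^ (2 : ℝ) /
        Metric.diam (Set.range (Fin.cons x z : Fin (m + 2) → Euc n)) ^ ((m * (m + 1) : ℝ) + (1 + 0) * 2))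
      ≤ 1 + ∑' k, (Set.univ.pi (fun _ : Fin (m + 1) => closedBall x (rr k))).indicator
        (fun z => (2 : ℝ≥0∞) ^ ((k + 1) * (m * (m + 1) + 2)) * ((m + 2 : ℕ) *
          (‖x - (a k + l k (q k x))‖ₑ ^ 2 + ∑ i, ‖z i - (a k + l k (q k (z i)))‖ₑ ^ 2))) z := by
  set w : Fin (m + 2) → Euc n := Fin.cons x z with hw
  have e1 : ((m * (m + 1) : ℝ) + (1 + 0) * 2) = ((m * (m + 1) + 2 : ℕ) : ℝ) := by push_cast; ring
  rw [e1, Real.rpow_natCast, Real.rpow_ofNat]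
  set d := Metric.diam (Set.range w) with hd
  have hbd : Bornology.IsBounded (Set.range w) := (Set.finite_range w).isBounded
  obtain ⟨j, hj⟩ := Finite.exists_max (fun i => dist (z i) x)
  set ρ := dist (z j) x with hρ
  have hρ0 : 0 < ρ := by
    refine dist_pos.2 fun h => ?_
    have : (w (Fin.succ j)) = w 0 := by simpa [hw] using h
    exact absurd (hz this) (Fin.succ_ne_zero _)
  have hρd : ρ ≤ d := by
    refine dist_le_diam_of_mem hbd ⟨Fin.succ j, by simp [hw]⟩ ⟨0, by simp [hw]⟩
  have hd0 : 0 < d := hρ0.trans_le hρd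
  by_cases h1 : ρ ≤ 1
  · obtain ⟨k, hk1, hk2⟩ := exists_rr hρ0 h1
    refine le_trans ?_ (le_add_left (ENNReal.le_tsum k))
    rw [Set.indicator_of_mem (by intro i _; exact (hj i).trans hk2)]
    have hs := hmin_sq_le w hz (a k) (l k) (hl k) (fun i => q k (w i))
    rw [Fin.sum_univ_succ] at hs
    simp only [hw, Fin.cons_zero, Fin.cons_succ] at hs
    rw [← hw] at hs
    rw [div_eq_inv_mul, ENNReal.ofReal_mul (by positivity)]
    refine mul_le_mul' ?_ hs
    have : (d ^ (m * (m + 1) + 2))⁻¹ ≤ 2 ^ ((k + 1) * (m * (m + 1) + 2)) := by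
      rw [pow_mul, ← inv_pow]
      refine pow_le_pow_left₀ (by positivity) ?_ _
      have h3 : rr (k + 1) ≤ d := hk1.le.trans hρd
      have h4 : (2 : ℝ) ^ (k + 1) = (rr (k + 1))⁻¹ := by
        rw [rr, ← inv_pow]; norm_num
      rw [h4]
      exact inv_anti₀ (rr_pos _) h3
    refine (ENNReal.ofReal_le_ofReal this).trans (le_of_eq ?_)
    rw [ENNReal.ofReal_pow (by norm_num)]; simp
  · refine le_trans ?_ le_self_add
    rw [← ENNReal.ofReal_one]
    refine ENNReal.ofReal_le_ofReal ?_
    rw [div_le_one (by positivity)]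
    have h3 : 1 ≤ d := (not_le.1 h1).le.trans hρd
    calc hmin w ^ 2 ≤ d ^ 2 := pow_le_pow_left₀ (hmin_nonneg w) (hmin_le_diam w hz) 2
      _ ≤ _ := pow_le_pow_right₀ h3 (by omega)

lemma Kcurv_le (μ : Measure (Euc n)) [IsFiniteMeasure μ] [NullSingletonClass μ] (x : Euc n)
    (C0 : ℝ≥0∞) (hC0 : ∀ r : ℝ, 0 < r → μ (closedBall x r) ≤ C0 * ENNReal.ofReal r ^ m)
    (a : ℕ → Euc n) (l : ℕ → Euc m → Euc n) (hl : ∀ k, IsLinearMap ℝ (l k))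
    (q : ℕ → Euc n → Euc m) (hP : ∀ k, Measurable fun y => a k + l k (q k y)) :
    Kcurv μ m 2 0 x ∞ ≤ μ Set.univ ^ (m + 1) +
      2 ^ (m * (m + 1) + 2) * (m + 2 : ℕ) * (m + 2 : ℕ) * (C0 ^ (m + 1) + C0 ^ m) *
      ∑' k, ((4 : ℝ≥0∞) ^ k * ‖x - (a k + l k (q k x))‖ₑ ^ 2 +
        ((2 : ℝ≥0∞) ^ k) ^ (m + 2) * ∫⁻ y in closedBall x (rr k), ‖y - (a k + l k (q k y))‖ₑ ^ 2 ∂μ) := by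
  have hD : ∀ k, Measurable fun y : Euc n => ‖y - (a k + l k (q k y))‖ₑ ^ 2 := fun k =>
    (measurable_id.sub (hP k)).enorm.pow_const _
  have hDi : ∀ k (i : Fin (m + 1)),
      Measurable fun z : Fin (m + 1) → Euc n => ‖z i - (a k + l k (q k (z i)))‖ₑ ^ 2 := fun k i =>
    (hD k).comp (measurable_pi_apply i)
  have hDs : ∀ k, Measurable fun z : Fin (m + 1) → Euc n =>
      ∑ i, ‖z i - (a k + l k (q k (z i)))‖ₑ ^ 2 := fun k =>
    Finset.measurable_sum _ fun i _ => hDi k i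
  have hS : ∀ k, MeasurableSet (Set.univ.pi (fun _ : Fin (m + 1) => closedBall x (rr k))) :=
    fun k => MeasurableSet.univ_pi fun _ => measurableSet_closedBall
  unfold Kcurv
  refine (setLIntegral_le_lintegral _ _).trans ?_
  refine (lintegral_mono_ae ((ae_injective μ x).mono fun z hz =>
    integrand_le x z hz a l hl q)).trans ?_
  rw [lintegral_add_left measurable_const, lintegral_const, one_mul]
  refine add_le_add (le_of_eq (by rw [Measure.pi_univ]; simp)) ?_
  rw [lintegral_tsum fun k => Measurable.aemeasurable <| Measurable.indicator
    (by have := hDs k; fun_prop) (hS k), ← ENNReal.tsum_mul_left]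
  refine ENNReal.tsum_le_tsum fun k => ?_
  rw [lintegral_indicator (hS k), lintegral_const_mul _ (by have := hDs k; fun_prop),
    lintegral_const_mul _ (by have := hDs k; fun_prop),
    lintegral_add_left measurable_const, lintegral_const,
    lintegral_finsetSum _ (fun i _ => hDi k i)]
  simp only [lintegral_pi_coord μ _ _ (hD k)]
  rw [Measure.restrict_apply_univ, Measure.pi_pi]
  simp only [Finset.prod_const, Finset.sum_const, Finset.card_univ, Fintype.card_fin, nsmul_eq_mul]
  set A := ‖x - (a k + l k (q k x))‖ₑ ^ 2
  set I := ∫⁻ y in closedBall x (rr k), ‖y - (a k + l k (q k y))‖ₑ ^ 2 ∂μ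
  set s := ENNReal.ofReal (rr k) with hs
  set t := (2 : ℝ≥0∞) ^ k with ht
  have hts : t * s = 1 := two_rr k
  have hB : μ (closedBall x (rr k)) ≤ C0 * s ^ m := hC0 _ (rr_pos k)
  have h4 : (4 : ℝ≥0∞) ^ k = t ^ 2 := by
    rw [ht, ← pow_mul, mul_comm, pow_mul]; norm_num
  have e1 : t ^ (m * (m + 1) + 2) * (C0 * s ^ m) ^ (m + 1) = C0 ^ (m + 1) * t ^ 2 := by
    have : t ^ (m * (m + 1) + 2) * (C0 * s ^ m) ^ (m + 1)
      = C0 ^ (m + 1) * t ^ 2 * (t * s) ^ (m * (m + 1)) := by ring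
    rw [this, hts]; simp
  have e2 : t ^ (m * (m + 1) + 2) * (C0 * s ^ m) ^ m = C0 ^ m * t ^ (m + 2) := by
    have : t ^ (m * (m + 1) + 2) * (C0 * s ^ m) ^ m
      = C0 ^ m * t ^ (m + 2) * (t * s) ^ (m * m) := by ring
    rw [this, hts]; simp
  have e3 : (2 : ℝ≥0∞) ^ ((k + 1) * (m * (m + 1) + 2)) =
      2 ^ (m * (m + 1) + 2) * t ^ (m * (m + 1) + 2) := by
    rw [ht]; ring
  rw [h4, e3]
  set W := (2 : ℝ≥0∞) ^ (m * (m + 1) + 2)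
  set T := t ^ (m * (m + 1) + 2)
  have hm1 : ((m + 1 : ℕ) : ℝ≥0∞) ≤ (m + 2 : ℕ) := by exact_mod_cast Nat.le_succ _
  have hm0 : (1 : ℝ≥0∞) ≤ (m + 2 : ℕ) := by exact_mod_cast (by omega : 1 ≤ m + 2)
  calc W * T * ((m + 2 : ℕ) * (A * μ (closedBall x (rr k)) ^ (m + 1)
          + (m + 1 : ℕ) * (μ (closedBall x (rr k)) ^ m * I)))
      ≤ W * T * ((m + 2 : ℕ) * ((m + 2 : ℕ) * A * (C0 * s ^ m) ^ (m + 1)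
          + (m + 2 : ℕ) * ((C0 * s ^ m) ^ m * I))) := by
        gcongr
        exact le_mul_of_one_le_left zero_le hm0
    _ = W * (m + 2 : ℕ) * (m + 2 : ℕ) * (A * (T * (C0 * s ^ m) ^ (m + 1))
          + (T * (C0 * s ^ m) ^ m) * I) := by ring
    _ = W * (m + 2 : ℕ) * (m + 2 : ℕ) * (C0 ^ (m + 1) * (t ^ 2 * A) + C0 ^ m * (t ^ (m + 2) * I)) := by
        rw [e1, e2]; ring
    _ ≤ W * (m + 2 : ℕ) * (m + 2 : ℕ) * ((C0 ^ (m + 1) + C0 ^ m) * (t ^ 2 * A)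
          + (C0 ^ (m + 1) + C0 ^ m) * (t ^ (m + 2) * I)) := by
        gcongr
        · exact le_self_add
        · exact le_add_self
    _ = _ := by ring

end RectK
/-! ### Part 5: measure lemmas -/

namespace RectK

variable {m n : ℕ}

lemma ballVol_pos : 0 < ballVol m := measure_closedBall_pos _ _ one_pos

lemma ballVol_ne_zero : ballVol m ≠ 0 := ballVol_pos.ne'

lemma ballVol_ne_top : ballVol m ≠ ∞ := measure_closedBall_lt_top.ne

lemma vol_cb (a : Euc m) {r : ℝ} (hr : 0 ≤ r) :
    volume (closedBall a r) = ENNReal.ofReal r ^ m * ballVol m := by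
  rw [Measure.addHaar_closedBall' _ _ hr, ENNReal.ofReal_pow hr]
  simp [ballVol]

/-- comparison of a measure with Lebesgue measure on a set of upper regularity -/
lemma measure_le_vol (ν : Measure (Euc m)) [IsFiniteMeasure ν] (C : ℝ≥0∞) (hC : C ≠ ∞)
    (s : Set (Euc m)) (hs : ∀ a ∈ s, ∀ r : ℝ, 0 < r → ν (closedBall a r) ≤ C * ENNReal.ofReal r ^ m) :
    ν s ≤ C * (ballVol m)⁻¹ * volume s := by
  have hC' : C * (ballVol m)⁻¹ ≠ ∞ :=
    ENNReal.mul_ne_top hC (ENNReal.inv_ne_top.2 ballVol_ne_zero)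
  lift C * (ballVol m)⁻¹ to ℝ≥0 using hC' with D hD
  have h := VitaliFamily.measure_le_of_frequently_le (v := Besicovitch.vitaliFamily ν)
    (ρ := ν) (D • (volume : Measure (Euc m))) Measure.AbsolutelyContinuous.rfl s
    (by
      intro x hx
      refine (Besicovitch.tendsto_filterAt ν x).frequently ?_
      refine Filter.Eventually.frequently ?_
      filter_upwards [self_mem_nhdsWithin] with r hr
      have hr : 0 < r := hr
      refine (hs x hx r hr).trans (le_of_eq ?_)
      rw [Measure.smul_apply, vol_cb _ hr.le, ENNReal.smul_def, hD, smul_eq_mul]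
      have : (ballVol m)⁻¹ * ballVol m = 1 := ENNReal.inv_mul_cancel ballVol_ne_zero ballVol_ne_top
      calc C * ENNReal.ofReal r ^ m = C * ENNReal.ofReal r ^ m * 1 := by ring
        _ = _ := by rw [← this]; ring)
  rwa [Measure.smul_apply, ENNReal.smul_def, smul_eq_mul] at h

/-- the set of upper regularity with constant `N` -/
def regSet (ν : Measure (Euc m)) (N : ℝ≥0∞) : Set (Euc m) :=
  {u | ∀ r : ℝ, 0 < r → ν (closedBall u r) ≤ N * ENNReal.ofReal r ^ m}

lemma isClosed_regSet (ν : Measure (Euc m)) (N : ℝ≥0∞) (hN : N ≠ ∞) : IsClosed (regSet ν N) := by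
  refine isClosed_of_closure_subset fun u hu r hr => ?_
  have h1 : ∀ ε : ℝ, 0 < ε → ν (closedBall u r) ≤ N * ENNReal.ofReal (r + ε) ^ m := by
    intro ε hε
    obtain ⟨v, hv, hd⟩ := Metric.mem_closure_iff.1 hu ε hε
    refine (measure_mono ?_).trans (hv (r + ε) (by positivity))
    exact closedBall_subset_closedBall' (by linarith)
  have h2 : Filter.Tendsto (fun ε : ℝ => N * ENNReal.ofReal (r + ε) ^ m) (nhdsWithin 0 (Ioi 0))
      (nhds (N * ENNReal.ofReal (r + 0) ^ m)) := by
    refine Filter.Tendsto.mono_left ?_ nhdsWithin_le_nhds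
    refine ENNReal.Tendsto.const_mul ?_ (Or.inr hN)
    refine ENNReal.Tendsto.pow ?_
    exact ENNReal.tendsto_ofReal (Continuous.tendsto (by fun_prop) 0)
  rw [add_zero] at h2
  refine ge_of_tendsto h2 ?_
  filter_upwards [self_mem_nhdsWithin] with ε hε using h1 ε hε

lemma ae_mem_regSet (ν : Measure (Euc m)) [IsFiniteMeasure ν] :
    ∀ᵐ u : Euc m, ∃ N : ℕ, u ∈ regSet ν N := by
  filter_upwards [Besicovitch.ae_tendsto_rnDeriv ν (volume : Measure (Euc m)),
    Measure.rnDeriv_lt_top ν (volume : Measure (Euc m))] with u hu hlt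
  have h1 := hu.eventually_lt_const (ENNReal.lt_add_right hlt.ne one_ne_zero)
  set L := ν.rnDeriv volume u + 1 with hL
  have hLt : L ≠ ∞ := by simp [hL, hlt.ne]
  obtain ⟨r0, hr0, h2⟩ := mem_nhdsGT_iff_exists_Ioo_subset.1 h1
  have hr0 : 0 < r0 := hr0
  set D := L * ballVol m + ν univ * (ENNReal.ofReal r0 ^ m)⁻¹ with hD
  have hDt : D ≠ ∞ := by
    refine ENNReal.add_ne_top.2 ⟨ENNReal.mul_ne_top hLt ballVol_ne_top, ENNReal.mul_ne_top
      (measure_ne_top _ _) (ENNReal.inv_ne_top.2 ?_)⟩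
    exact pow_ne_zero _ (by simpa using hr0)
  obtain ⟨N, hN⟩ := ENNReal.exists_nat_gt hDt
  refine ⟨N, fun r hr => ?_⟩
  refine le_trans ?_ (mul_le_mul_left hN.le _)
  rw [hD, add_mul]
  by_cases hrr : r < r0
  · refine le_trans ?_ le_self_add
    have h3 : ν (closedBall u r) / volume (closedBall u r) ≤ L := le_of_lt (h2 ⟨hr, hrr⟩)
    have h4 := ENNReal.div_le_iff (measure_closedBall_pos volume u hr).ne'
      measure_closedBall_lt_top.ne |>.1 h3
    rw [vol_cb _ hr.le] at h4
    refine h4.trans (le_of_eq (by ring))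
  · refine le_trans ?_ le_add_self
    push Not at hrr
    have h5 : ENNReal.ofReal r0 ^ m ≤ ENNReal.ofReal r ^ m := by gcongr
    have h6 : (ENNReal.ofReal r0 ^ m)⁻¹ * ENNReal.ofReal r0 ^ m = 1 :=
      ENNReal.inv_mul_cancel (pow_ne_zero _ (by simpa using hr0)) (by simp)
    calc ν (closedBall u r) ≤ ν univ := measure_mono (subset_univ _)
      _ = ν univ * ((ENNReal.ofReal r0 ^ m)⁻¹ * ENNReal.ofReal r0 ^ m) := by rw [h6, mul_one]
      _ ≤ ν univ * ((ENNReal.ofReal r0 ^ m)⁻¹ * ENNReal.ofReal r ^ m) := by gcongr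
      _ = _ := by ring

lemma geom_partial (a : ℝ≥0∞) (K : ℕ) :
    ∑ k ∈ Finset.range (K + 1), (4 : ℝ≥0∞) ^ k * a ≤ 2 * (4 ^ K * a) := by
  induction K with
  | zero => simp; exact le_mul_of_one_le_left zero_le (by norm_num)
  | succ K ih =>
    rw [Finset.sum_range_succ]
    refine (add_le_add_left ih _).trans ?_
    have : (2 : ℝ≥0∞) * (4 ^ K * a) ≤ 4 * (4 ^ K * a) := by gcongr; norm_num
    calc _ ≤ 4 * (4 ^ K * a) + 4 ^ (K + 1) * a := by gcongr
      _ = _ := by ring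

lemma geom_cut (a c : ℝ≥0∞) :
    ∑' k : ℕ, (if (4 : ℝ≥0∞) ^ k * a ≤ c then (4 : ℝ≥0∞) ^ k * a else 0) ≤ 2 * c := by
  rw [ENNReal.tsum_eq_iSup_nat]
  refine iSup_le fun K => ?_
  induction K with
  | zero => simp
  | succ K ih =>
    by_cases h : (4 : ℝ≥0∞) ^ K * a ≤ c
    · refine le_trans (Finset.sum_le_sum (g := fun k => (4 : ℝ≥0∞) ^ k * a) fun k _ => ?_)
        ((geom_partial a K).trans (by gcongr))
      split_ifs <;> simp
    · rw [Finset.sum_range_succ, if_neg h, add_zero]; exact ih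

lemma zsum {X : Type*} [MeasurableSpace X] (μ : Measure X) [SFinite μ] (p : X → Euc m)
    (hp : Measurable p) (e : X → ℝ≥0∞) (he : Measurable e) (Λ : ℝ) (hΛ : 0 ≤ Λ) (c : ℝ≥0∞) :
    ∫⁻ x0, ∑' k, ((2 : ℝ≥0∞) ^ k) ^ (m + 2) *
      ∫⁻ y, {y | dist (p y) x0 ≤ Λ * rr k ∧ e y ≤ c * ENNReal.ofReal (rr k)}.indicator
        (fun y => e y ^ 2) y ∂μ
      ≤ ENNReal.ofReal Λ ^ m * ballVol m * (2 * c ^ 2) * μ univ := by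
  have hmeasS : ∀ k, MeasurableSet {q : Euc m × X |
      dist (p q.2) q.1 ≤ Λ * rr k ∧ e q.2 ≤ c * ENNReal.ofReal (rr k)} := fun k =>
    (measurableSet_le ((hp.comp measurable_snd).dist measurable_fst) measurable_const).inter
      (measurableSet_le (he.comp measurable_snd) measurable_const)
  have hmeas : ∀ k, Measurable fun q : Euc m × X =>
      {y | dist (p y) q.1 ≤ Λ * rr k ∧ e y ≤ c * ENNReal.ofReal (rr k)}.indicator
        (fun y => e y ^ 2) q.2 := fun k =>
    Measurable.indicator (f := fun q : Euc m × X => e q.2 ^ 2)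
      ((he.comp measurable_snd).pow_const 2) (hmeasS k)
  rw [lintegral_tsum fun k => ((hmeas k).lintegral_prod_right'.const_mul _).aemeasurable]
  have key : ∀ k, ∫⁻ x0, ((2 : ℝ≥0∞) ^ k) ^ (m + 2) *
      ∫⁻ y, {y | dist (p y) x0 ≤ Λ * rr k ∧ e y ≤ c * ENNReal.ofReal (rr k)}.indicator
        (fun y => e y ^ 2) y ∂μ ≤ ENNReal.ofReal Λ ^ m * ballVol m *
        ∫⁻ y, (if (4 : ℝ≥0∞) ^ k * e y ^ 2 ≤ c ^ 2 then (4 : ℝ≥0∞) ^ k * e y ^ 2 else 0) ∂μ := by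
    intro k
    rw [lintegral_const_mul _ (hmeas k).lintegral_prod_right',
      lintegral_lintegral_swap (hmeas k).aemeasurable]
    rw [← lintegral_const_mul, ← lintegral_const_mul]
    rotate_left
    · exact Measurable.ite (measurableSet_le (by fun_prop) measurable_const) (by fun_prop)
        measurable_const
    · exact (hmeas k).lintegral_prod_left'
    refine lintegral_mono fun y => ?_
    set s := ENNReal.ofReal (rr k) with hs
    set t := (2 : ℝ≥0∞) ^ k with ht
    have hts : t * s = 1 := two_rr k
    have h4 : (4 : ℝ≥0∞) ^ k = t ^ 2 := by
      rw [ht, ← pow_mul, mul_comm, pow_mul]; norm_num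
    by_cases hy : e y ≤ c * s
    · have h1 : (4 : ℝ≥0∞) ^ k * e y ^ 2 ≤ c ^ 2 := by
        calc (4 : ℝ≥0∞) ^ k * e y ^ 2 ≤ t ^ 2 * (c * s) ^ 2 := by rw [h4]; gcongr
          _ = c ^ 2 * (t * s) ^ 2 := by ring
          _ = c ^ 2 := by rw [hts]; simp
      rw [if_pos h1]
      have h2 : ∫⁻ x0, {y | dist (p y) x0 ≤ Λ * rr k ∧ e y ≤ c * s}.indicator
          (fun y => e y ^ 2) y = e y ^ 2 * (ENNReal.ofReal (Λ * rr k) ^ m * ballVol m) := by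
        rw [← vol_cb (p y) (mul_nonneg hΛ (rr_pos k).le), ← lintegral_indicator_const
          measurableSet_closedBall]
        refine lintegral_congr fun x0 => ?_
        by_cases hx : dist (p y) x0 ≤ Λ * rr k
        · rw [Set.indicator_of_mem (s := {y | dist (p y) x0 ≤ Λ * rr k ∧ e y ≤ c * s}) ⟨hx, hy⟩,
            Set.indicator_of_mem]
          rwa [mem_closedBall, dist_comm]
        · rw [Set.indicator_of_notMem (s := {y | dist (p y) x0 ≤ Λ * rr k ∧ e y ≤ c * s})
            (fun h => hx h.1), Set.indicator_of_notMem]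
          rwa [mem_closedBall, dist_comm]
      change t ^ (m + 2) * (∫⁻ x0, {y | dist (p y) x0 ≤ Λ * rr k ∧ e y ≤ c * s}.indicator
          (fun y => e y ^ 2) y) ≤ _
      rw [h2, h4, ENNReal.ofReal_mul hΛ, ← hs]
      refine le_of_eq ?_
      calc _ = ENNReal.ofReal Λ ^ m * ballVol m * (t ^ 2 * e y ^ 2) * (t * s) ^ m := by ring
        _ = _ := by rw [hts]; simp
    · refine le_trans (le_of_eq ?_) zero_le
      have : ∀ x0 : Euc m, {y | dist (p y) x0 ≤ Λ * rr k ∧ e y ≤ c * s}.indicator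
          (fun y => e y ^ 2) y = 0 := fun x0 => Set.indicator_of_notMem (fun h => hy h.2) _
      simp only [this]; simp
  refine (ENNReal.tsum_le_tsum key).trans ?_
  rw [ENNReal.tsum_mul_left, ← lintegral_tsum]
  rotate_left
  · exact fun k => (Measurable.ite (measurableSet_le (by fun_prop) measurable_const) (by fun_prop)
        measurable_const).aemeasurable
  rw [mul_assoc _ (2 * c ^ 2)]
  gcongr
  refine (lintegral_mono fun y => geom_cut (e y ^ 2) (c ^ 2)).trans ?_
  rw [lintegral_const]

end RectK
/-! ### Part 6: transfer of square integrals from a measure to Lebesgue measure -/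

namespace RectK

variable {m n : ℕ}

/-- the kernel used for averaging -/
def avk (E : Set (Euc m)) (u u' : Euc m) : ℝ≥0∞ :=
  {q : Euc m × Euc m | dist q.1 q.2 ≤ infDist q.1 E / 2}.indicator
    (fun q => (ballVol m)⁻¹ * (ENNReal.ofReal (infDist q.1 E / 2) ^ m)⁻¹) (u, u')

lemma measurable_avk (E : Set (Euc m)) : Measurable fun q : Euc m × Euc m => avk E q.1 q.2 := by
  unfold avk
  have h : Measurable fun q : Euc m × Euc m => infDist q.1 E / 2 :=
    ((continuous_infDist_pt E).measurable.comp measurable_fst).div_const 2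
  refine Measurable.indicator ?_ (measurableSet_le (measurable_fst.dist measurable_snd) h)
  exact ((h.ennreal_ofReal.pow_const m).inv).const_mul _

lemma measurable_avk_left (E : Set (Euc m)) (u' : Euc m) : Measurable fun u => avk E u u' :=
  Measurable.comp (g := fun q : Euc m × Euc m => avk E q.1 q.2) (f := fun u => (u, u'))
    (measurable_avk E) measurable_prodMk_right

lemma avk_le (ν : Measure (Euc m)) (N : ℝ≥0∞) (E : Set (Euc m))
    (hEc : IsClosed E) (hEn : E.Nonempty) (hE : E ⊆ regSet ν N) (u' : Euc m) :
    ∫⁻ u in Eᶜ, avk E u u' ∂ν ≤ N * (ballVol m)⁻¹ * 6 ^ m := by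
  set d := infDist u' E with hd
  have hd0 : 0 ≤ d := infDist_nonneg
  have hbd : ∀ u, dist u u' ≤ infDist u E / 2 → d / 3 ≤ infDist u E / 2 ∧ infDist u E / 2 ≤ d := by
    intro u hu
    have h1 : infDist u' E ≤ infDist u E + dist u' u := infDist_le_infDist_add_dist
    have h2 : infDist u E ≤ infDist u' E + dist u u' := infDist_le_infDist_add_dist
    rw [dist_comm u' u] at h1
    constructor <;> linarith
  rcases hd0.eq_or_lt with h0 | h0
  · refine le_trans (le_of_eq ?_) zero_le
    rw [setLIntegral_congr_fun (g := fun _ => 0) hEc.measurableSet.compl]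
    · simp
    · intro u hu
      refine Set.indicator_of_notMem (fun h => ?_) _
      have h1 := (hbd u h).2
      have h2 : 0 < infDist u E := (hEc.notMem_iff_infDist_pos hEn).1 hu
      linarith
  · obtain ⟨e, he, hde⟩ := hEc.exists_infDist_eq_dist hEn u'
    have hle : ∀ u, avk E u u' ≤ (closedBall e (2 * d)).indicator
        (fun _ => (ballVol m)⁻¹ * (ENNReal.ofReal (d / 3) ^ m)⁻¹) u := by
      intro u
      by_cases hu : dist u u' ≤ infDist u E / 2
      · have h1 := hbd u hu
        have hmem : u ∈ closedBall e (2 * d) := by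
          rw [mem_closedBall]
          have := dist_triangle u u' e
          linarith
        rw [Set.indicator_of_mem hmem]
        unfold avk
        rw [Set.indicator_of_mem (by exact hu)]
        refine mul_le_mul' le_rfl (ENNReal.inv_le_inv.2 ?_)
        exact pow_le_pow_left' (ENNReal.ofReal_le_ofReal h1.1) m
      · unfold avk
        rw [Set.indicator_of_notMem (by exact hu)]
        exact zero_le
    refine (setLIntegral_le_lintegral _ _).trans ((lintegral_mono hle).trans ?_)
    rw [lintegral_indicator_const measurableSet_closedBall]
    have h2 := hE he (2 * d) (by positivity)
    have h3 : ENNReal.ofReal (2 * d) = 6 * ENNReal.ofReal (d / 3) := by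
      rw [show 2 * d = 6 * (d / 3) by ring, ENNReal.ofReal_mul (by norm_num)]; simp
    rw [h3] at h2
    set s := ENNReal.ofReal (d / 3) with hs
    have hs1 : (s ^ m)⁻¹ * s ^ m = 1 := by
      refine ENNReal.inv_mul_cancel (pow_ne_zero _ ?_) (by simp [hs])
      have : 0 < d / 3 := by positivity
      simpa [hs] using this
    calc _ ≤ (ballVol m)⁻¹ * (s ^ m)⁻¹ * (N * (6 * s) ^ m) := by gcongr
      _ = N * (ballVol m)⁻¹ * 6 ^ m * ((s ^ m)⁻¹ * s ^ m) := by ring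
      _ ≤ _ := by rw [hs1, mul_one]

lemma avg_bound (E : Set (Euc m)) (hEc : IsClosed E) 
    (L : ℝ≥0) (G : Euc m → Euc n) (hG : LipschitzWith L G) (x : Euc m) (hx : x ∈ E) (r : ℝ)
    (u : Euc m) (hu : u ∈ closedBall x r) (huE : u ∉ E) :
    ‖G u‖ₑ ^ 2 ≤ 2 * (∫⁻ u' in closedBall x (2 * r), avk E u u' * ‖G u'‖ₑ ^ 2) +
      L ^ 2 * ENNReal.ofReal (infDist u E) ^ 2 := by
  set d := infDist u E / 2 with hd
  have hdpos : 0 < infDist u E := (hEc.notMem_iff_infDist_pos ⟨x, hx⟩).1 huE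
  have hd0 : 0 < d := by positivity
  have hdr : infDist u E ≤ r := (infDist_le_dist_of_mem hx).trans hu
  set s := ENNReal.ofReal d with hs
  have hs0 : s ≠ 0 := by simpa [hs] using hd0
  have hcb : closedBall u d ⊆ closedBall x (2 * r) := by
    refine closedBall_subset_closedBall' ?_
    rw [mem_closedBall] at hu; linarith
  have hone : (ballVol m)⁻¹ * (s ^ m)⁻¹ * volume (closedBall u d) = 1 := by
    rw [vol_cb _ hd0.le, ← hs]
    calc _ = ((ballVol m)⁻¹ * ballVol m) * ((s ^ m)⁻¹ * s ^ m) := by ring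
      _ = 1 := by
        rw [ENNReal.inv_mul_cancel ballVol_ne_zero ballVol_ne_top,
          ENNReal.inv_mul_cancel (pow_ne_zero _ hs0) (by simp [hs]), mul_one]
  have hpt : ∀ u' ∈ closedBall u d, ‖G u‖ₑ ^ 2 ≤ 2 * ‖G u'‖ₑ ^ 2 + 2 * (L * s) ^ 2 := by
    intro u' hu'
    have h1 : ‖G u - G u'‖ₑ ≤ L * s := by
      rw [← edist_eq_enorm_sub]
      refine (hG u u').trans ?_
      gcongr
      rw [edist_dist, dist_comm]
      exact ENNReal.ofReal_le_ofReal hu'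
    calc ‖G u‖ₑ ^ 2 = ‖G u' + (G u - G u')‖ₑ ^ 2 := by rw [add_sub_cancel]
      _ ≤ 2 * ‖G u'‖ₑ ^ 2 + 2 * ‖G u - G u'‖ₑ ^ 2 := enorm_sq_add_le _ _
      _ ≤ _ := by gcongr
  have hGm : Measurable fun u' => ‖G u'‖ₑ ^ 2 := hG.continuous.measurable.enorm.pow_const 2
  have hInt : ‖G u‖ₑ ^ 2 * volume (closedBall u d) ≤
      2 * (∫⁻ u' in closedBall u d, ‖G u'‖ₑ ^ 2) + 2 * (L * s) ^ 2 * volume (closedBall u d) := by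
    rw [← setLIntegral_const, ← setLIntegral_const (closedBall u d) (2 * (L * s) ^ 2),
      ← lintegral_const_mul _ hGm, ← lintegral_add_right _ measurable_const]
    exact setLIntegral_mono_ae ((hGm.const_mul 2).add_const _).aemeasurable (Filter.Eventually.of_forall fun u' hu' => hpt u' hu')
  have hav : (ballVol m)⁻¹ * (s ^ m)⁻¹ * (∫⁻ u' in closedBall u d, ‖G u'‖ₑ ^ 2) ≤
      ∫⁻ u' in closedBall x (2 * r), avk E u u' * ‖G u'‖ₑ ^ 2 := by
    refine le_trans ?_ (lintegral_mono_set hcb)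
    rw [← lintegral_const_mul _ hGm]
    refine setLIntegral_mono_ae ((((measurable_avk E).comp measurable_prodMk_left).mul hGm).aemeasurable)
      (Filter.Eventually.of_forall fun u' hu' => ?_)
    unfold avk
    rw [Set.indicator_of_mem (by rw [mem_closedBall, dist_comm] at hu'; exact hu')]
  calc ‖G u‖ₑ ^ 2 = (ballVol m)⁻¹ * (s ^ m)⁻¹ * (‖G u‖ₑ ^ 2 * volume (closedBall u d)) := by
        rw [mul_left_comm, hone, mul_one]
    _ ≤ (ballVol m)⁻¹ * (s ^ m)⁻¹ * (2 * (∫⁻ u' in closedBall u d, ‖G u'‖ₑ ^ 2)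
        + 2 * (L * s) ^ 2 * volume (closedBall u d)) := by gcongr
    _ = 2 * ((ballVol m)⁻¹ * (s ^ m)⁻¹ * (∫⁻ u' in closedBall u d, ‖G u'‖ₑ ^ 2))
        + 2 * (L * s) ^ 2 * ((ballVol m)⁻¹ * (s ^ m)⁻¹ * volume (closedBall u d)) := by ring
    _ ≤ _ := by
      rw [hone, mul_one]
      refine add_le_add (mul_le_mul' le_rfl hav) ?_
      have : ENNReal.ofReal (infDist u E) = 2 * s := by
        rw [hs, show infDist u E = 2 * d by rw [hd]; ring, ENNReal.ofReal_mul (by norm_num)]; simp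
      rw [this]
      calc 2 * (L * s) ^ 2 ≤ 4 * (L * s) ^ 2 := by gcongr; norm_num
        _ = _ := by ring

lemma sigma_bound (ν : Measure (Euc m)) [IsFiniteMeasure ν] (N : ℝ≥0∞) (hN : N ≠ ∞) (E : Set (Euc m))
    (hEc : IsClosed E) (hE : E ⊆ regSet ν N)
    (L : ℝ≥0) (G : Euc m → Euc n) (hG : LipschitzWith L G) (x : Euc m) (hx : x ∈ E) (r : ℝ) (hr : 0 < r) :
    ∫⁻ u in closedBall x r, ‖G u‖ₑ ^ 2 ∂ν ≤
      N * (ballVol m)⁻¹ * (1 + 2 * 6 ^ m) * (∫⁻ u in closedBall x (2 * r), ‖G u‖ₑ ^ 2) +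
      L ^ 2 * ∫⁻ u in closedBall x r, ENNReal.ofReal (infDist u E) ^ 2 ∂ν := by
  have hGm : Measurable fun u' => ‖G u'‖ₑ ^ 2 := hG.continuous.measurable.enorm.pow_const 2
  have hdm : Measurable fun u : Euc m => ENNReal.ofReal (infDist u E) ^ 2 :=
    ((continuous_infDist_pt E).measurable.ennreal_ofReal).pow_const 2
  rw [← lintegral_inter_add_sdiff _ (closedBall x r) hEc.measurableSet]
  have hA : ∫⁻ u in closedBall x r ∩ E, ‖G u‖ₑ ^ 2 ∂ν ≤
      N * (ballVol m)⁻¹ * (∫⁻ u in closedBall x (2 * r), ‖G u‖ₑ ^ 2) := by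
    rw [← smul_eq_mul (N * (ballVol m)⁻¹), ← lintegral_smul_measure]
    refine lintegral_mono' ?_ le_rfl
    refine Measure.le_iff.2 fun s hs => ?_
    rw [Measure.restrict_apply hs, Measure.smul_apply, smul_eq_mul, Measure.restrict_apply hs]
    refine (measure_le_vol ν N hN _ (fun a ha => hE ha.2.2)).trans ?_
    gcongr
    refine inter_subset_left.trans (closedBall_subset_closedBall (by linarith))
  have hB : ∫⁻ u in closedBall x r \ E, ‖G u‖ₑ ^ 2 ∂ν ≤
      2 * (N * (ballVol m)⁻¹ * 6 ^ m * (∫⁻ u in closedBall x (2 * r), ‖G u‖ₑ ^ 2)) +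
      L ^ 2 * ∫⁻ u in closedBall x r, ENNReal.ofReal (infDist u E) ^ 2 ∂ν := by
    have hmk : Measurable fun q : Euc m × Euc m => avk E q.1 q.2 * ‖G q.2‖ₑ ^ 2 :=
      (measurable_avk E).mul (hGm.comp measurable_snd)
    have hin : Measurable fun u => ∫⁻ u' in closedBall x (2 * r), avk E u u' * ‖G u'‖ₑ ^ 2 :=
      hmk.lintegral_prod_right'
    have h1 : ∫⁻ u in closedBall x r \ E, ‖G u‖ₑ ^ 2 ∂ν ≤ ∫⁻ u in closedBall x r \ E,
        (2 * (∫⁻ u' in closedBall x (2 * r), avk E u u' * ‖G u'‖ₑ ^ 2) +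
        L ^ 2 * ENNReal.ofReal (infDist u E) ^ 2) ∂ν :=
      setLIntegral_mono_ae ((hin.const_mul 2).add (hdm.const_mul _)).aemeasurable (Filter.Eventually.of_forall fun u hu =>
        avg_bound E hEc L G hG x hx r u hu.1 hu.2)
    refine h1.trans ?_
    rw [lintegral_add_left (hin.const_mul 2), lintegral_const_mul _ hin,
      lintegral_const_mul _ hdm]
    refine add_le_add (mul_le_mul' le_rfl ?_) (mul_le_mul' le_rfl ?_)
    · refine (lintegral_mono_set (sdiff_subset_compl _ _)).trans ?_
      rw [lintegral_lintegral_swap hmk.aemeasurable, ← lintegral_const_mul _ hGm]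
      refine lintegral_mono fun u' => ?_
      have hm1 : Measurable fun u => avk E u u' := measurable_avk_left E u'
      rw [lintegral_mul_const _ hm1]
      gcongr
      exact avk_le ν N E hEc ⟨x, hx⟩ hE u'
    · exact lintegral_mono_set sdiff_subset
  refine (add_le_add hA hB).trans (le_of_eq (by ring))

end RectK
/-! ### Part 7: finiteness of the curvature on a good part of a chart -/

namespace RectK

variable {m n : ℕ}

lemma zsum_ae {X : Type*} [MeasurableSpace X] (μ : Measure X) [IsFiniteMeasure μ] (p : X → Euc m)
    (hp : Measurable p) (e : X → ℝ≥0∞) (he : Measurable e) (Λ : ℝ) (hΛ : 0 ≤ Λ) (c : ℝ≥0∞)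
    (hc : c ≠ ∞) :
    ∀ᵐ x0 : Euc m, ∑' k, ((2 : ℝ≥0∞) ^ k) ^ (m + 2) *
      ∫⁻ y, {y | dist (p y) x0 ≤ Λ * rr k ∧ e y ≤ c * ENNReal.ofReal (rr k)}.indicator
        (fun y => e y ^ 2) y ∂μ < ∞ := by
  have hmeasS : ∀ k, MeasurableSet {q : Euc m × X |
      dist (p q.2) q.1 ≤ Λ * rr k ∧ e q.2 ≤ c * ENNReal.ofReal (rr k)} := fun k =>
    (measurableSet_le ((hp.comp measurable_snd).dist measurable_fst) measurable_const).inter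
      (measurableSet_le (he.comp measurable_snd) measurable_const)
  have hmeas : ∀ k, Measurable fun q : Euc m × X =>
      {y | dist (p y) q.1 ≤ Λ * rr k ∧ e y ≤ c * ENNReal.ofReal (rr k)}.indicator
        (fun y => e y ^ 2) q.2 := fun k =>
    Measurable.indicator (f := fun q : Euc m × X => e q.2 ^ 2)
      ((he.comp measurable_snd).pow_const 2) (hmeasS k)
  refine ae_lt_top (Measurable.tsum fun k => (hmeas k).lintegral_prod_right'.const_mul _) ?_
  refine ne_top_of_le_ne_top ?_ (zsum μ p hp e he Λ hΛ c)
  refine ENNReal.mul_ne_top (ENNReal.mul_ne_top (ENNReal.mul_ne_top (by simp) ballVol_ne_top) ?_)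
    (measure_ne_top _ _)
  exact ENNReal.mul_ne_top (by simp) (by simp [hc])

/-- scaling of integrals over balls -/
lemma lintegral_ball_scale (x0 : Euc m) (s R : ℝ) (hs : 0 < s) (f : Euc m → ℝ≥0∞)
    (hf : Measurable f) :
    ∫⁻ u in closedBall x0 (R * s), f u =
      ENNReal.ofReal s ^ m * ∫⁻ h in closedBall (0 : Euc m) R, f (x0 + s • h) := by
  have h1 : ∫⁻ h in closedBall (0 : Euc m) R, f (x0 + s • h) =
      ∫⁻ h : Euc m, (closedBall x0 (R * s)).indicator f (x0 + s • h) := by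
    rw [← lintegral_indicator measurableSet_closedBall]
    refine lintegral_congr fun h => ?_
    have : h ∈ closedBall (0 : Euc m) R ↔ x0 + s • h ∈ closedBall x0 (R * s) := by
      rw [mem_closedBall, mem_closedBall, dist_zero_right, dist_eq_norm, add_sub_cancel_left,
        norm_smul, Real.norm_of_nonneg hs.le, mul_comm s, mul_le_mul_iff_left₀ hs]
    by_cases hh : h ∈ closedBall (0 : Euc m) R
    · rw [indicator_of_mem hh, indicator_of_mem (this.1 hh)]
    · rw [indicator_of_notMem hh, indicator_of_notMem (fun h' => hh (this.2 h'))]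
  have hF : Measurable ((closedBall x0 (R * s)).indicator f) := hf.indicator measurableSet_closedBall
  have h2 : ∫⁻ h : Euc m, (closedBall x0 (R * s)).indicator f (x0 + s • h) =
      ∫⁻ u, (closedBall x0 (R * s)).indicator f (x0 + u) ∂(Measure.map (s • ·) (volume : Measure (Euc m))) := by
    rw [lintegral_map (by fun_prop) (by fun_prop)]
  rw [h1, h2, Measure.map_addHaar_smul _ hs.ne', lintegral_smul_measure,
    lintegral_add_left_eq_self, lintegral_indicator measurableSet_closedBall, smul_eq_mul, ← mul_assoc]
  have h3 : ENNReal.ofReal s ^ m * ENNReal.ofReal |(s ^ Module.finrank ℝ (Euc m))⁻¹| = 1 := by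
    rw [← ENNReal.ofReal_pow hs.le, ← ENNReal.ofReal_mul (by positivity), abs_of_pos (by positivity)]
    rw [finrank_euclideanSpace_fin, mul_inv_cancel₀ (by positivity), ENNReal.ofReal_one]
  rw [h3, one_mul]

set_option maxHeartbeats 1600000 in
theorem core (μ : Measure (Euc n)) [IsFiniteMeasure μ] [NullSingletonClass μ]
    (C0 : ℝ≥0∞) (hC0t : C0 ≠ ∞)
    (hC0 : ∀ x, ∀ r : ℝ, 0 < r → μ (closedBall x r) ≤ C0 * ENNReal.ofReal r ^ m)
    (F : Euc m → Euc n) (K : ℝ≥0) (hK : LipschitzWith K F) (hFc : HasCompactSupport F)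
    (g : Euc n → Euc m) (Λ : ℝ≥0) (hΛ : 1 ≤ Λ) (hg : LipschitzWith Λ g)
    (E : Set (Euc m)) (hEc : IsClosed E) (N : ℝ≥0∞) (hN : N ≠ ∞) (hE : E ⊆ regSet (μ.map g) N)
    (hEg : ∀ v ∈ E, g (F v) = v) :
    ∀ᵐ x0 : Euc m, x0 ∈ E → Kcurv μ m 2 0 (F x0) ∞ < ∞ := by
  have hΛ' : (1 : ℝ) ≤ Λ := by exact_mod_cast hΛ
  have hΛ0 : (0 : ℝ) < Λ := by linarith
  have hgm : Measurable g := hg.continuous.measurable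
  obtain ⟨a, l, K', C, hC, hcont, hlin, hlb, hsum⟩ := dorronsoro hK hFc (2 * Λ) (by positivity)
  set ν := μ.map g with hν
  have : IsFiniteMeasure ν := Measure.isFiniteMeasure_map μ g
  -- joint continuity
  have hjc : ∀ k, Continuous fun p : Euc m × Euc m =>
      F (p.1 + rr k • p.2) - (a k p.1 + l k p.1 p.2) := fun k =>
    (hK.continuous.comp (by fun_prop)).sub (hcont k)
  have hjm : ∀ k, Measurable fun p : Euc m × Euc m =>
      ‖F (p.1 + rr k • p.2) - (a k p.1 + l k p.1 p.2)‖ₑ ^ 2 := fun k =>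
    (hjc k).measurable.enorm.pow_const 2
  -- the four almost everywhere finite sums
  have hT1 : ∀ᵐ x0 : Euc m, ∑' k, (4 : ℝ≥0∞) ^ k *
      ‖F (x0 + rr k • (0 : Euc m)) - (a k x0 + l k x0 0)‖ₑ ^ 2 < ∞ := by
    have hmm : ∀ k, Measurable fun x0 : Euc m =>
        ‖F (x0 + rr k • (0 : Euc m)) - (a k x0 + l k x0 0)‖ₑ ^ 2 := fun k =>
      Measurable.comp (g := fun p : Euc m × Euc m =>
        ‖F (p.1 + rr k • p.2) - (a k p.1 + l k p.1 p.2)‖ₑ ^ 2) (f := fun x0 => (x0, 0))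
        (hjm k) measurable_prodMk_right
    refine ae_lt_top (Measurable.tsum fun k => (hmm k).const_mul _) ?_
    rw [lintegral_tsum fun k => ((hmm k).const_mul _).aemeasurable]
    simp only [lintegral_const_mul _ (hmm _)]
    exact ne_top_of_le_ne_top hC (hsum 0 (mem_closedBall_self (by positivity)))
  have hT3 : ∀ᵐ x0 : Euc m, ∑' k, (4 : ℝ≥0∞) ^ k * ∫⁻ h in closedBall (0 : Euc m) (2 * Λ),
      ‖F (x0 + rr k • h) - (a k x0 + l k x0 h)‖ₑ ^ 2 < ∞ := by
    have hmm : ∀ k, Measurable fun x0 : Euc m => ∫⁻ h in closedBall (0 : Euc m) (2 * Λ),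
        ‖F (x0 + rr k • h) - (a k x0 + l k x0 h)‖ₑ ^ 2 := fun k =>
      (hjm k).lintegral_prod_right'
    have hmm2 : ∀ k, Measurable fun h : Euc m => ∫⁻ x0 : Euc m,
        ‖F (x0 + rr k • h) - (a k x0 + l k x0 h)‖ₑ ^ 2 := fun k =>
      (hjm k).lintegral_prod_left'
    refine ae_lt_top (Measurable.tsum fun k => (hmm k).const_mul _) ?_
    rw [lintegral_tsum fun k => ((hmm k).const_mul _).aemeasurable]
    have hsw : ∀ k, ∫⁻ x0 : Euc m, ∫⁻ h in closedBall (0 : Euc m) (2 * Λ),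
        ‖F (x0 + rr k • h) - (a k x0 + l k x0 h)‖ₑ ^ 2 = ∫⁻ h in closedBall (0 : Euc m) (2 * Λ),
        ∫⁻ x0 : Euc m, ‖F (x0 + rr k • h) - (a k x0 + l k x0 h)‖ₑ ^ 2 := fun k =>
      lintegral_lintegral_swap (hjm k).aemeasurable
    simp only [lintegral_const_mul _ (hmm _), hsw]
    simp only [← lintegral_const_mul _ (hmm2 _)]
    rw [← lintegral_tsum fun k => ((hmm2 k).const_mul _).aemeasurable]
    refine ne_top_of_le_ne_top ?_ (setLIntegral_mono_ae (g := fun _ => C) (by fun_prop)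
      (Filter.Eventually.of_forall hsum))
    rw [setLIntegral_const]
    exact ENNReal.mul_ne_top hC measure_closedBall_lt_top.ne
  have hem : Measurable fun y : Euc n => ‖y - F (g y)‖ₑ :=
    (measurable_id.sub (hK.continuous.measurable.comp hgm)).enorm
  have hZ1 := zsum_ae μ g hgm (fun y => ‖y - F (g y)‖ₑ) hem Λ hΛ0.le (1 + K * Λ)
    (by simp [ENNReal.mul_ne_top])
  have hdm : Measurable fun u : Euc m => ENNReal.ofReal (infDist u E) :=
    (continuous_infDist_pt E).measurable.ennreal_ofReal
  have hZ2 := zsum_ae ν id measurable_id (fun u => ENNReal.ofReal (infDist u E)) hdm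
    Λ hΛ0.le Λ (by simp)
  filter_upwards [hT1, hT3, hZ1, hZ2] with x0 h1 h3 z1 z2 hx0
  set q : ℕ → Euc n → Euc m := fun k y => (rr k)⁻¹ • (g y - x0) with hq
  have hqc : ∀ k, Continuous (q k) := fun k => by
    have := hg.continuous
    fun_prop
  have hAc : ∀ k, Continuous fun h : Euc m => a k x0 + l k x0 h := fun k =>
    (hcont k).comp (Continuous.prodMk_right x0)
  have hPm : ∀ k, Measurable fun y => a k x0 + l k x0 (q k y) := fun k =>
    ((hAc k).comp (hqc k)).measurable
  have hKc := Kcurv_le μ (F x0) C0 (hC0 (F x0)) (fun k => a k x0) (fun k => l k x0)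
    (fun k => hlin k x0) q hPm
  refine hKc.trans_lt ?_
  refine ENNReal.add_lt_top.2 ⟨by simp, ?_⟩
  refine ENNReal.mul_lt_top ?_ ?_
  · refine ENNReal.mul_lt_top (ENNReal.mul_lt_top (ENNReal.mul_lt_top (by simp) (by simp)) (by simp)) ?_
    exact ENNReal.add_lt_top.2 ⟨ENNReal.pow_lt_top hC0t.lt_top, ENNReal.pow_lt_top hC0t.lt_top⟩
  set D := N * (ballVol m)⁻¹ * (1 + 2 * 6 ^ m) with hD
  have hDt : D < ∞ := by
    refine ENNReal.mul_lt_top (ENNReal.mul_lt_top hN.lt_top (ENNReal.inv_lt_top.2 ballVol_pos)) ?_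
    exact ENNReal.add_lt_top.2 ⟨by simp, ENNReal.mul_lt_top (by simp) (ENNReal.pow_lt_top (by simp))⟩
  set Z1 : ℕ → ℝ≥0∞ := fun k => ((2 : ℝ≥0∞) ^ k) ^ (m + 2) *
      ∫⁻ y, {y | dist (g y) x0 ≤ Λ * rr k ∧ ‖y - F (g y)‖ₑ ≤ (1 + K * Λ) * ENNReal.ofReal (rr k)}.indicator
        (fun y => ‖y - F (g y)‖ₑ ^ 2) y ∂μ with hZ1d
  set Z2 : ℕ → ℝ≥0∞ := fun k => ((2 : ℝ≥0∞) ^ k) ^ (m + 2) *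
      ∫⁻ u, {u | dist (id u) x0 ≤ Λ * rr k ∧ ENNReal.ofReal (infDist u E) ≤ Λ * ENNReal.ofReal (rr k)}.indicator
        (fun u => ENNReal.ofReal (infDist u E) ^ 2) u ∂ν with hZ2d
  set T1 : ℕ → ℝ≥0∞ := fun k => (4 : ℝ≥0∞) ^ k *
      ‖F (x0 + rr k • (0 : Euc m)) - (a k x0 + l k x0 0)‖ₑ ^ 2 with hT1d
  set T3 : ℕ → ℝ≥0∞ := fun k => (4 : ℝ≥0∞) ^ k * ∫⁻ h in closedBall (0 : Euc m) (2 * Λ),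
      ‖F (x0 + rr k • h) - (a k x0 + l k x0 h)‖ₑ ^ 2 with hT3d
  set L : ℝ≥0 := K + K' with hL
  have hmain : ∀ k, ((4 : ℝ≥0∞) ^ k * ‖F x0 - (a k x0 + l k x0 (q k (F x0)))‖ₑ ^ 2 +
        ((2 : ℝ≥0∞) ^ k) ^ (m + 2) * ∫⁻ y in closedBall (F x0) (rr k),
          ‖y - (a k x0 + l k x0 (q k y))‖ₑ ^ 2 ∂μ) ≤
      T1 k + (2 * Z1 k + 2 * (D * T3 k + L ^ 2 * Z2 k)) := by
    intro k
    have hk0 := rr_pos k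
    have hdist : ∀ y ∈ closedBall (F x0) (rr k), dist (g y) x0 ≤ Λ * rr k := by
      intro y hy
      have := hg.dist_le_mul y (F x0)
      rw [hEg x0 hx0] at this
      exact this.trans (by gcongr; exact hy)
    refine add_le_add ?_ ?_
    · simp only [hT1d, hq, hEg x0 hx0, sub_self, smul_zero, add_zero]
      exact le_rfl
    set G : Euc m → Euc n := fun u => F u - (a k x0 + l k x0 ((rr k)⁻¹ • (u - x0))) with hG
    have hGL : LipschitzWith L G := by
      refine LipschitzWith.of_dist_le_mul fun u v => ?_
      rw [dist_eq_norm, dist_eq_norm]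
      have e1 : G u - G v = (F u - F v) - l k x0 ((rr k)⁻¹ • (u - v)) := by
        have : (rr k)⁻¹ • (u - v) = (rr k)⁻¹ • (u - x0) - (rr k)⁻¹ • (v - x0) := by
          rw [← smul_sub]; congr 1; abel
        rw [this, (hlin k x0).map_sub]
        simp only [hG]; abel
      rw [e1]
      refine (norm_sub_le _ _).trans ?_
      have e2 := hK.dist_le_mul u v
      rw [dist_eq_norm, dist_eq_norm] at e2
      have e3 := hlb k x0 ((rr k)⁻¹ • (u - v))
      rw [norm_smul, Real.norm_of_nonneg (by positivity), ← mul_assoc,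
        mul_assoc (K' : ℝ) (rr k), mul_inv_cancel₀ hk0.ne', mul_one] at e3
      rw [hL]; push_cast; linarith
    have hGm : Measurable fun u => ‖G u‖ₑ ^ 2 := hGL.continuous.measurable.enorm.pow_const 2
    have b1 : ∫⁻ y in closedBall (F x0) (rr k), ‖y - (a k x0 + l k x0 (q k y))‖ₑ ^ 2 ∂μ ≤
        2 * (∫⁻ y in closedBall (F x0) (rr k), ‖y - F (g y)‖ₑ ^ 2 ∂μ) +
        2 * ∫⁻ y in closedBall (F x0) (rr k), ‖G (g y)‖ₑ ^ 2 ∂μ := by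
      have hm2 : Measurable fun y => ‖G (g y)‖ₑ ^ 2 := hGm.comp hgm
      rw [← lintegral_const_mul _ (hem.pow_const 2), ← lintegral_const_mul _ hm2,
        ← lintegral_add_left ((hem.pow_const 2).const_mul 2)]
      refine lintegral_mono fun y => ?_
      have : y - (a k x0 + l k x0 (q k y)) = (y - F (g y)) + G (g y) := by
        simp only [hG, hq]; abel
      rw [this]
      exact enorm_sq_add_le _ _
    have b2 : ((2 : ℝ≥0∞) ^ k) ^ (m + 2) *
        (∫⁻ y in closedBall (F x0) (rr k), ‖y - F (g y)‖ₑ ^ 2 ∂μ) ≤ Z1 k := by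
      simp only [hZ1d]
      refine mul_le_mul' le_rfl ?_
      rw [← lintegral_indicator measurableSet_closedBall]
      refine lintegral_mono fun y => Set.indicator_le_indicator_of_subset ?_ (fun _ => zero_le) y
      intro y hy
      refine ⟨hdist y hy, ?_⟩
      have h5 : ‖y - F (g y)‖ ≤ (1 + K * Λ) * rr k := by
        have e1 := hK.dist_le_mul x0 (g y)
        have e2 := hdist y hy
        have e3 : dist y (F x0) ≤ rr k := hy
        rw [← dist_eq_norm]
        have e4 := dist_triangle y (F x0) (F (g y))
        have e5 : (K : ℝ) * dist x0 (g y) ≤ K * (Λ * rr k) := by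
          rw [dist_comm x0]; gcongr
        linarith
      rw [← ofReal_norm]
      refine (ENNReal.ofReal_le_ofReal h5).trans (le_of_eq ?_)
      rw [ENNReal.ofReal_mul (by positivity), ENNReal.ofReal_add (by norm_num) (by positivity),
        ENNReal.ofReal_mul (by positivity)]
      simp
    have b3 : ∫⁻ y in closedBall (F x0) (rr k), ‖G (g y)‖ₑ ^ 2 ∂μ ≤
        ∫⁻ u in closedBall x0 (Λ * rr k), ‖G u‖ₑ ^ 2 ∂ν := by
      rw [hν, setLIntegral_map measurableSet_closedBall hGm hgm]
      exact lintegral_mono_set fun y hy => hdist y hy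
    have b4 := sigma_bound ν N hN E hEc hE L G hGL x0 hx0 (Λ * rr k) (by positivity)
    have b5 : ((2 : ℝ≥0∞) ^ k) ^ (m + 2) * (∫⁻ u in closedBall x0 (2 * (Λ * rr k)), ‖G u‖ₑ ^ 2) = T3 k := by
      rw [← mul_assoc, lintegral_ball_scale x0 (rr k) (2 * Λ) hk0 _ hGm]
      have e1 : ∀ h : Euc m, G (x0 + rr k • h) = F (x0 + rr k • h) - (a k x0 + l k x0 h) := by
        intro h
        simp only [hG, add_sub_cancel_left, smul_smul, inv_mul_cancel₀ hk0.ne', one_smul]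
      simp only [e1, hT3d]
      set t := (2 : ℝ≥0∞) ^ k with ht
      have hts : t * ENNReal.ofReal (rr k) = 1 := two_rr k
      have h4 : (4 : ℝ≥0∞) ^ k = t ^ 2 := by
        rw [ht, ← pow_mul, mul_comm, pow_mul]; norm_num
      rw [h4, ← mul_assoc]
      congr 1
      calc _ = t ^ 2 * (t * ENNReal.ofReal (rr k)) ^ m := by ring
        _ = _ := by rw [hts]; simp
    have b6 : ((2 : ℝ≥0∞) ^ k) ^ (m + 2) *
        (∫⁻ u in closedBall x0 (Λ * rr k), ENNReal.ofReal (infDist u E) ^ 2 ∂ν) ≤ Z2 k := by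
      simp only [hZ2d]
      refine mul_le_mul' le_rfl ?_
      rw [← lintegral_indicator measurableSet_closedBall]
      refine lintegral_mono fun y => Set.indicator_le_indicator_of_subset ?_ (fun _ => zero_le) y
      intro u hu
      refine ⟨hu, ?_⟩
      have : infDist u E ≤ Λ * rr k := (infDist_le_dist_of_mem hx0).trans hu
      refine (ENNReal.ofReal_le_ofReal this).trans (le_of_eq ?_)
      rw [ENNReal.ofReal_mul (by positivity)]; simp
    set t := ((2 : ℝ≥0∞) ^ k) ^ (m + 2)
    set I1 := ∫⁻ y in closedBall (F x0) (rr k), ‖y - F (g y)‖ₑ ^ 2 ∂μ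
    set I2 := ∫⁻ u in closedBall x0 (2 * (Λ * rr k)), ‖G u‖ₑ ^ 2
    set I3 := ∫⁻ u in closedBall x0 (Λ * rr k), ENNReal.ofReal (infDist u E) ^ 2 ∂ν
    calc _ ≤ t * (2 * I1 + 2 * (D * I2 + L ^ 2 * I3)) := by
          refine mul_le_mul' le_rfl (b1.trans ?_)
          exact add_le_add le_rfl (mul_le_mul' le_rfl (b3.trans b4))
      _ = 2 * (t * I1) + 2 * (D * (t * I2) + L ^ 2 * (t * I3)) := by ring
      _ ≤ _ := by
        rw [b5]
        exact add_le_add (mul_le_mul' le_rfl b2) (mul_le_mul' le_rfl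
          (add_le_add le_rfl (mul_le_mul' le_rfl b6)))
  refine (ENNReal.tsum_le_tsum hmain).trans_lt ?_
  rw [ENNReal.tsum_add, ENNReal.tsum_add, ENNReal.tsum_mul_left, ENNReal.tsum_mul_left,
    ENNReal.tsum_add, ENNReal.tsum_mul_left, ENNReal.tsum_mul_left]
  refine ENNReal.add_lt_top.2 ⟨h1, ENNReal.add_lt_top.2 ⟨ENNReal.mul_lt_top (by simp) z1,
    ENNReal.mul_lt_top (by simp) (ENNReal.add_lt_top.2 ⟨ENNReal.mul_lt_top hDt h3,
      ENNReal.mul_lt_top (ENNReal.pow_lt_top (by simp)) z2⟩)⟩⟩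

end RectK
/-! ### Part 8: charts and conclusion -/

namespace RectK

variable {m n : ℕ}

lemma upper_all (μ : Measure (Euc n)) (M : ℝ)
    (hupper : ∀ x ∈ sptMeasure μ, ∀ r : ℝ, 0 < r →
      μ (closedBall x r) < ENNReal.ofReal M * ballVol m * ENNReal.ofReal r ^ m)
    (y : Euc n) (r : ℝ) (hr : 0 < r) :
    μ (closedBall y r) ≤ ENNReal.ofReal M * ballVol m * 2 ^ m * ENNReal.ofReal r ^ m := by
  by_cases h : ∃ x ∈ closedBall y r, x ∈ sptMeasure μ
  · obtain ⟨x, hx, hs⟩ := h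
    have h1 : closedBall y r ⊆ closedBall x (2 * r) := by
      refine closedBall_subset_closedBall' ?_
      rw [mem_closedBall, dist_comm] at hx
      linarith
    refine (measure_mono h1).trans ((hupper x hs (2 * r) (by positivity)).le.trans (le_of_eq ?_))
    rw [ENNReal.ofReal_mul (by norm_num)]
    simp only [ENNReal.ofReal_ofNat]
    ring
  · push Not at h
    refine le_trans (le_of_eq ?_) zero_le
    refine measure_null_of_locally_null _ fun x hx => ?_
    have h1 := h x hx
    simp only [sptMeasure, mem_ofPred_eq, not_forall, not_lt] at h1
    obtain ⟨ε, hε, h2⟩ := h1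
    exact ⟨ball x ε, mem_nhdsWithin_of_mem_nhds (ball_mem_nhds x hε), le_antisymm h2 zero_le⟩

lemma nullSingleton_of_upper (hm : 0 < m) (μ : Measure (Euc n)) (C0 : ℝ≥0∞) (hC0t : C0 ≠ ∞)
    (hC0 : ∀ x, ∀ r : ℝ, 0 < r → μ (closedBall x r) ≤ C0 * ENNReal.ofReal r ^ m) :
    NullSingletonClass μ := by
  refine ⟨fun x => ?_⟩
  have h2 : Filter.Tendsto (fun ε : ℝ => C0 * ENNReal.ofReal ε ^ m) (nhdsWithin 0 (Ioi 0))
      (nhds (C0 * ENNReal.ofReal 0 ^ m)) := by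
    refine Filter.Tendsto.mono_left ?_ nhdsWithin_le_nhds
    refine ENNReal.Tendsto.const_mul ?_ (Or.inr hC0t)
    refine ENNReal.Tendsto.pow ?_
    exact ENNReal.tendsto_ofReal (Continuous.tendsto (by fun_prop) 0)
  rw [ENNReal.ofReal_zero, zero_pow hm.ne', mul_zero] at h2
  refine le_antisymm (ge_of_tendsto h2 ?_) zero_le
  filter_upwards [self_mem_nhdsWithin] with ε hε
  have hε : 0 < ε := hε
  refine (measure_mono ?_).trans (hC0 x ε hε)
  simpa using hε.le

theorem chart_null (μ : Measure (Euc n)) [IsFiniteMeasure μ] [NullSingletonClass μ]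
    (C0 : ℝ≥0∞) (hC0t : C0 ≠ ∞)
    (hC0 : ∀ x, ∀ r : ℝ, 0 < r → μ (closedBall x r) ≤ C0 * ENNReal.ofReal r ^ m)
    (F : Euc m → Euc n) (K : ℝ≥0) (hK : LipschitzWith K F) (hFc : HasCompactSupport F)
    (g : Euc n → Euc m) (Λ : ℝ≥0) (hΛ : 1 ≤ Λ) (hg : LipschitzWith Λ g)
    (B : Set (Euc m)) (hB : IsCompact B) (hBg : ∀ v ∈ B, g (F v) = v) :
    μ (F '' B ∩ {y | ¬ Kcurv μ m 2 0 y ∞ < ∞}) = 0 := by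
  set Z : Set (Euc m) := {v | v ∈ B ∧ ¬ Kcurv μ m 2 0 (F v) ∞ < ∞} with hZ
  have hgm : Measurable g := hg.continuous.measurable
  have : IsFiniteMeasure (μ.map g) := Measure.isFiniteMeasure_map μ g
  have hZ0 : volume Z = 0 := by
    have h1 : ∀ N : ℕ, ∀ᵐ x0 : Euc m, x0 ∈ regSet (μ.map g) N ∩ B →
        Kcurv μ m 2 0 (F x0) ∞ < ∞ := fun N =>
      core μ C0 hC0t hC0 F K hK hFc g Λ hΛ hg _
        ((isClosed_regSet _ _ (by simp)).inter hB.isClosed) N (by simp) inter_subset_left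
        (fun v hv => hBg v hv.2)
    have h2 : ∀ᵐ x0 : Euc m, x0 ∉ Z := by
      filter_upwards [ae_all_iff.2 h1, ae_mem_regSet (μ.map g)] with x0 hx0 hN hxZ
      obtain ⟨N, hN⟩ := hN
      exact hxZ.2 (hx0 N ⟨hN, hxZ.1⟩)
    rw [ae_iff] at h2
    simpa using h2
  have hFB : MeasurableSet (F '' B) := (hB.image hK.continuous).measurableSet
  set ρ := (μ.restrict (F '' B)).map g with hρ
  have : IsFiniteMeasure ρ := Measure.isFiniteMeasure_map _ g
  have hρZ : ρ Z ≤ (C0 * (K + 1) ^ m) * (ballVol m)⁻¹ * volume Z := by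
    refine measure_le_vol ρ _ (ENNReal.mul_ne_top hC0t (ENNReal.pow_ne_top (by simp))) Z ?_
    intro v hv r hr
    rw [hρ, Measure.map_apply hgm measurableSet_closedBall, Measure.restrict_apply
      (hgm measurableSet_closedBall)]
    refine (measure_mono (t := closedBall (F v) ((K + 1) * r)) ?_).trans
      ((hC0 _ _ (by positivity)).trans (le_of_eq ?_))
    · rintro _ ⟨hy, w, hw, rfl⟩
      rw [mem_preimage, hBg w hw] at hy
      rw [mem_closedBall] at hy ⊢
      refine (hK.dist_le_mul w v).trans ?_
      gcongr
      simp
    · rw [ENNReal.ofReal_mul (by positivity), ENNReal.ofReal_add (by positivity) (by norm_num)]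
      simp only [ENNReal.ofReal_coe_nnreal, ENNReal.ofReal_one]
      rw [mul_pow, mul_assoc]
  rw [hZ0, mul_zero] at hρZ
  have hsub : F '' B ∩ {y | ¬ Kcurv μ m 2 0 y ∞ < ∞} ⊆ g ⁻¹' Z ∩ F '' B := by
    rintro _ ⟨⟨v, hv, rfl⟩, hy⟩
    refine ⟨?_, v, hv, rfl⟩
    rw [mem_preimage, hBg v hv]
    exact ⟨hv, hy⟩
  refine le_antisymm ((measure_mono hsub).trans ?_) zero_le
  rw [← Measure.restrict_apply' hFB]
  exact (Measure.le_map_apply hgm.aemeasurable Z).trans hρZ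

lemma chart_exists (V : Set (Euc m)) (hV : IsOpen V) (f : Euc m → Euc n)
    (hf : ContDiffOn ℝ 1 f V) (v0 : Euc m) (hv0 : v0 ∈ V)
    (hinj : Function.Injective (fderivWithin ℝ f V v0)) :
    ∃ ε > 0, ∃ (F : Euc m → Euc n) (K : ℝ≥0) (g : Euc n → Euc m) (Λ : ℝ≥0),
      LipschitzWith K F ∧ HasCompactSupport F ∧ 1 ≤ Λ ∧ LipschitzWith Λ g ∧
      ∀ v ∈ closedBall v0 ε, F v = f v ∧ g (F v) = v := by
  rw [fderivWithin_of_isOpen hV hv0] at hinj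
  have hst : HasStrictFDerivAt f (fderiv ℝ f v0) v0 :=
    (hf.contDiffAt (hV.mem_nhds hv0)).hasStrictFDerivAt one_ne_zero
  set f' := fderiv ℝ f v0 with hf'
  obtain ⟨A, hA0, hA⟩ := (f' : Euc m →ₗ[ℝ] Euc n).exists_antilipschitzWith
    (LinearMap.ker_eq_bot.2 hinj)
  set c : ℝ≥0 := (2 * A)⁻¹ with hc
  have hc0 : 0 < c := by positivity
  obtain ⟨s, hs, happ⟩ := hst.approximates_deriv_on_nhds (c := c) (Or.inr hc0)
  obtain ⟨ε, hε, hεs⟩ := Metric.nhds_basis_closedBall.mem_iff.1 hs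
  have hlow : ∀ x ∈ closedBall v0 ε, ∀ y ∈ closedBall v0 ε, dist x y ≤ 2 * A * dist (f x) (f y) := by
    intro x hx y hy
    have h1 := happ x (hεs hx) y (hεs hy)
    have h2 : dist x y ≤ A * ‖f' (x - y)‖ := by
      have := hA.le_mul_dist x y
      rw [dist_eq_norm (_ : Euc n)] at this
      simpa using this
    rw [dist_eq_norm, dist_eq_norm] at *
    have h3 : ‖f' (x - y)‖ ≤ ‖f x - f y‖ + c * ‖x - y‖ := by
      have := norm_sub_norm_le (f' (x - y)) (f x - f y)
      rw [norm_sub_rev (f' (x - y))] at this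
      linarith
    have h4 : (A : ℝ) * c = 1 / 2 := by
      rw [hc]; push_cast
      have : (A : ℝ) ≠ 0 := by exact_mod_cast hA0.ne'
      field_simp
    have h5 : (A : ℝ) * ‖f' (x - y)‖ ≤ A * (‖f x - f y‖ + c * ‖x - y‖) := by gcongr
    have h6 : (A : ℝ) * (‖f x - f y‖ + c * ‖x - y‖) = A * ‖f x - f y‖ + (A * c) * ‖x - y‖ := by ring
    rw [h4] at h6
    linarith
  have hup : ∀ x ∈ closedBall v0 ε, ∀ y ∈ closedBall v0 ε,
      dist (f x) (f y) ≤ (‖f'‖₊ + c : ℝ≥0) * dist x y := by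
    intro x hx y hy
    have h1 := happ x (hεs hx) y (hεs hy)
    have h2 := f'.le_opNorm (x - y)
    rw [dist_eq_norm, dist_eq_norm]
    have h3 := norm_sub_norm_le (f x - f y) (f' (x - y))
    push_cast
    linarith
  -- the inverse
  have hginv : ∃ (g : Euc n → Euc m) (Λ : ℝ≥0), 1 ≤ Λ ∧ LipschitzWith Λ g ∧
      ∀ v ∈ closedBall v0 ε, g (f v) = v := by
    have hinjB : InjOn f (closedBall v0 ε) := by
      intro x hx y hy hxy
      have := hlow x hx y hy
      rw [hxy, dist_self, mul_zero] at this
      exact dist_le_zero.1 this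
    have hL : LipschitzOnWith (2 * A) (Function.invFunOn f (closedBall v0 ε)) (f '' closedBall v0 ε) := by
      refine LipschitzOnWith.of_dist_le_mul ?_
      rintro _ ⟨x, hx, rfl⟩ _ ⟨y, hy, rfl⟩
      rw [hinjB.leftInvOn_invFunOn hx, hinjB.leftInvOn_invFunOn hy]
      exact_mod_cast hlow x hx y hy
    obtain ⟨g, hg, heq⟩ := hL.extend_finite_dimension
    refine ⟨g, lipschitzExtensionConstant (Euc m) * (2 * A) + 1, le_add_self,
      hg.weaken le_self_add, fun v hv => ?_⟩
    rw [← heq (mem_image_of_mem f hv), hinjB.leftInvOn_invFunOn hv]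
  obtain ⟨g, Λ, hΛ, hg, hgf⟩ := hginv
  -- the extension
  have hext : ∃ (F : Euc m → Euc n) (K : ℝ≥0), LipschitzWith K F ∧ HasCompactSupport F ∧
      ∀ v ∈ closedBall v0 ε, F v = f v := by
    classical
    set F0 : Euc m → Euc n := fun v => if v ∈ closedBall v0 ε then f v else 0 with hF0
    set Kf : ℝ≥0 := ‖f'‖₊ + c
    set Mx : ℝ≥0 := ‖f v0‖₊ + Kf * ⟨ε, hε.le⟩ with hMx
    have hMb : ∀ v ∈ closedBall v0 ε, ‖f v‖ ≤ Mx := by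
      intro v hv
      have h1 := hup v hv v0 (mem_closedBall_self hε.le)
      have h2 : (Kf : ℝ) * dist v v0 ≤ Kf * ε := by gcongr; exact hv
      have h3 := norm_sub_norm_le (f v) (f v0)
      rw [dist_eq_norm] at h1
      have h4 : (Mx : ℝ) = ‖f v0‖ + Kf * ε := by rw [hMx]; push_cast; rfl
      rw [h4]; linarith
    have hL : LipschitzOnWith (Kf + Mx) F0 (closedBall v0 ε ∪ (closedBall v0 (ε + 1))ᶜ) := by
      refine LipschitzOnWith.of_dist_le_mul ?_
      have key : ∀ x ∈ closedBall v0 ε, ∀ y ∈ (closedBall v0 (ε + 1))ᶜ,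
          dist (F0 x) (F0 y) ≤ (Kf + Mx : ℝ≥0) * dist x y := by
        intro x hx y hy
        have hy1 : ε + 1 < dist y v0 := by simpa using hy
        have hy2 : y ∉ closedBall v0 ε := by rw [mem_closedBall]; linarith
        simp only [hF0, if_pos hx, if_neg hy2, dist_zero_right]
        have hx' : dist x v0 ≤ ε := hx
        have h1 : 1 ≤ dist x y := by
          have := dist_triangle y x v0
          rw [dist_comm y x] at this
          linarith
        calc ‖f x‖ ≤ Mx := hMb x hx
          _ ≤ (Kf + Mx : ℝ≥0) * 1 := by rw [mul_one]; exact_mod_cast le_add_self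
          _ ≤ _ := by gcongr
      rintro x (hx | hx) y (hy | hy)
      · simp only [hF0, if_pos hx, if_pos hy]
        refine (hup x hx y hy).trans ?_
        gcongr
        exact le_self_add
      · exact key x hx y hy
      · rw [dist_comm, dist_comm x]; exact key y hy x hx
      · have hx2 : x ∉ closedBall v0 ε := fun h =>
          hx (closedBall_subset_closedBall (by linarith) h)
        have hy2 : y ∉ closedBall v0 ε := fun h =>
          hy (closedBall_subset_closedBall (by linarith) h)
        simp only [hF0, if_neg hx2, if_neg hy2, dist_self]
        positivity
    obtain ⟨F, hF, heq⟩ := hL.extend_finite_dimension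
    refine ⟨F, _, hF, ?_, fun v hv => ?_⟩
    · refine HasCompactSupport.intro (isCompact_closedBall v0 (ε + 1)) fun x hx => ?_
      have hx2 : x ∉ closedBall v0 ε := fun h =>
          hx (closedBall_subset_closedBall (by linarith) h)
      rw [← heq (Or.inr hx)]
      simp only [hF0, if_neg hx2]
    · rw [← heq (Or.inl hv)]
      simp only [hF0, if_pos hv]
  obtain ⟨F, K, hF, hFc, hFf⟩ := hext
  exact ⟨ε, hε, F, K, g, Λ, hF, hFc, hΛ, hg, fun v hv => ⟨hFf v hv, by rw [hFf v hv, hgf v hv]⟩⟩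

theorem main (hm : 0 < m) (μ : Measure (Euc n)) (hfin : μ Set.univ ≠ ∞)
    (hrect : ∃ A : Set (Set (Euc n)), A.Countable ∧ (∀ S ∈ A, IsC1Submanifold m S) ∧
      μ (Set.univ \ ⋃₀ A) = 0)
    (M : ℝ) 
    (hupper : ∀ x ∈ sptMeasure μ, ∀ r : ℝ, 0 < r →
      μ (closedBall x r) < ENNReal.ofReal M * ballVol m * ENNReal.ofReal r ^ m) :
    ∀ᵐ x ∂μ, Kcurv μ m 2 0 x ∞ < ∞ := by
  have : IsFiniteMeasure μ := ⟨hfin.lt_top⟩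
  set C0 : ℝ≥0∞ := ENNReal.ofReal M * ballVol m * 2 ^ m with hC0d
  have hC0t : C0 ≠ ∞ := ENNReal.mul_ne_top (ENNReal.mul_ne_top (by simp) ballVol_ne_top)
    (ENNReal.pow_ne_top (by simp))
  have hC0 : ∀ x, ∀ r : ℝ, 0 < r → μ (closedBall x r) ≤ C0 * ENNReal.ofReal r ^ m :=
    fun x r hr => upper_all μ M hupper x r hr
  have : NullSingletonClass μ := nullSingleton_of_upper hm μ C0 hC0t hC0
  obtain ⟨A, hAc, hAS, hA0⟩ := hrect
  set bad : Set (Euc n) := {y | ¬ Kcurv μ m 2 0 y ∞ < ∞} with hbad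
  have hS : ∀ S ∈ A, μ (S ∩ bad) = 0 := by
    intro S hSA
    refine measure_null_of_locally_null _ fun x hx => ?_
    obtain ⟨U, V, f, hU, hxU, hV, hf, -, hfV, hinj⟩ := hAS S hSA x hx.1
    refine ⟨U ∩ (S ∩ bad), Filter.inter_mem (mem_nhdsWithin_of_mem_nhds (hU.mem_nhds hxU))
      self_mem_nhdsWithin, ?_⟩
    have hch := fun v (hv : v ∈ V) => chart_exists V hV f hf v hv (hinj v hv)
    choose! ε hε F K g Λ hF hFc hΛ hg hFg using hch
    obtain ⟨t, htV, htc, hcov⟩ := TopologicalSpace.countable_cover_nhdsWithin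
      (f := fun v => closedBall v (ε v)) (s := V)
      (fun v hv => mem_nhdsWithin_of_mem_nhds (closedBall_mem_nhds v (hε v hv)))
    have hnull : μ (⋃ v ∈ t, (F v '' closedBall v (ε v) ∩ bad)) = 0 := by
      refine (measure_biUnion_null_iff htc).2 fun v hv => ?_
      have hvV := htV hv
      exact chart_null μ C0 hC0t hC0 (F v) (K v) (hF v hvV) (hFc v hvV) (g v) (Λ v) (hΛ v hvV)
        (hg v hvV) (closedBall v (ε v)) (isCompact_closedBall _ _) (fun w hw => (hFg v hvV w hw).2)
    refine measure_mono_null ?_ hnull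
    rintro y ⟨hyU, hyS, hyb⟩
    have : y ∈ f '' V := by rw [hfV]; exact ⟨hyS, hyU⟩
    obtain ⟨w, hw, rfl⟩ := this
    obtain ⟨v, hv, hwv⟩ := mem_iUnion₂.1 (hcov hw)
    exact mem_iUnion₂.2 ⟨v, hv, ⟨w, hwv, (hFg v (htV hv) w hwv).1⟩, hyb⟩
  rw [ae_iff]
  refine measure_mono_null (t := (Set.univ \ ⋃₀ A) ∪ ⋃ S ∈ A, (S ∩ bad)) ?_ ?_
  · intro y hy
    by_cases h : y ∈ ⋃₀ A
    · obtain ⟨S, hSA, hyS⟩ := h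
      exact Or.inr (mem_iUnion₂.2 ⟨S, hSA, hyS, hy⟩)
    · exact Or.inl ⟨mem_univ _, h⟩
  · exact measure_union_null hA0 ((measure_biUnion_null_iff hAc).2 hS)

end RectK
/-- Corollary (rectifiable): if ℝⁿ is countably `(μ,m)` rectifiable, `μ(ℝⁿ) < ∞`, and
`μ(B̄(x,r)) < M ω_m r^m` on the support, then `K_{μ,2}^0(x,∞) < ∞` for μ-a.e. `x`. -/
theorem stmt3 (n m : ℕ) (hm : 0 < m) (hmn : m < n) (μ : Measure (Euc n))
    [IsLocallyFiniteMeasure μ] (hfin : μ Set.univ ≠ ∞)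
    (hrect : ∃ A : Set (Set (Euc n)), A.Countable ∧ (∀ S ∈ A, IsC1Submanifold m S) ∧
      μ (Set.univ \ ⋃₀ A) = 0)
    (M : ℝ) (hM : 0 < M)
    (hupper : ∀ x ∈ sptMeasure μ, ∀ r : ℝ, 0 < r →
      μ (closedBall x r) < ENNReal.ofReal M * ballVol m * ENNReal.ofReal r ^ m) :
    ∀ᵐ x ∂μ, Kcurv μ m 2 0 x ∞ < ∞ := by
  exact RectK.main hm μ hfin hrect M hupper
end
end

section
/- Let 0 < m < n be integers, let p ∈ [m(m+1),∞), and let M ∈ (0,∞). There exists a constant Γ = Γ(n,m,p) ∈ (0,∞) such that for every Radon measure μ on ℝⁿ satisfying μ(B̄(x,r)) ≤ M·ω_m·r^m for all x ∈ ℝⁿ and r ∈ (0,∞), one has M_p(μ) ≤ Γ · M^m · ∫ ∫₀^∞ r^{m(m+1)−p} · β_{μ,p}(x,r)^p · dr/r dμ(x). -/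
open MeasureTheory Metric Set
open scoped ENNReal NNReal

noncomputable section

/-- Extend a subspace to one of prescribed dimension. -/
lemma aux_extend {V : Type*} [AddCommGroup V] [Module ℝ V] [FiniteDimensional ℝ V]
    (W : Submodule ℝ V) (j : ℕ) (h : Module.finrank ℝ W + j ≤ Module.finrank ℝ V) :
    ∃ W' : Submodule ℝ V, W ≤ W' ∧ Module.finrank ℝ W' = Module.finrank ℝ W + j := by
  induction j with
  | zero => exact ⟨W, le_rfl, rfl⟩
  | succ j ih =>
    obtain ⟨W', hW, hf⟩ := ih (by omega)
    have hne : W' ≠ ⊤ := by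
      rintro rfl
      rw [finrank_top] at hf
      omega
    obtain ⟨v, hv⟩ : ∃ v, v ∉ W' := by
      by_contra hcon
      push Not at hcon
      exact hne (Submodule.eq_top_iff'.2 hcon)
    refine ⟨W' ⊔ Submodule.span ℝ {v}, hW.trans le_sup_left, ?_⟩
    have h1 := Submodule.finrank_sup_add_finrank_inf_eq W' (Submodule.span ℝ {v})
    have hv0 : v ≠ 0 := by rintro rfl; exact hv (zero_mem _)
    have h2 : W' ⊓ Submodule.span ℝ {v} = ⊥ :=
      (Submodule.disjoint_span_singleton' hv0).2 hv |>.eq_bot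
    rw [h2, finrank_bot, finrank_span_singleton hv0] at h1
    omega

/-- Good orthonormal frame. -/
lemma aux_frame {n m : ℕ} (hmn : m < n) (U : Submodule ℝ (Euc n))
    (hU : Module.finrank ℝ U = m) (u : Fin (m + 1) → Euc n) :
    ∃ b : Fin (m + 1) → Euc n, Orthonormal ℝ b ∧ (∀ z ∈ U, inner ℝ (b 0) z = 0) ∧
      ∀ z ∈ Submodule.span ℝ (Set.range u), z = ∑ i, inner ℝ (b i) z • b i := by
  have hn : Module.finrank ℝ (Euc n) = n := by simp
  have hle : Module.finrank ℝ (Submodule.span ℝ (Set.range u)) ≤ m + 1 := by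
    simpa [Set.finrank] using finrank_range_le_card (R := ℝ) u
  obtain ⟨W, hW, hWf⟩ := aux_extend (Submodule.span ℝ (Set.range u))
    (m + 1 - Module.finrank ℝ (Submodule.span ℝ (Set.range u))) (by omega)
  have hWf' : Module.finrank ℝ W = m + 1 := by omega
  have h1 := Submodule.finrank_sup_add_finrank_inf_eq W Uᗮ
  have h2 := U.finrank_add_finrank_orthogonal
  have h3 : Module.finrank ℝ (W ⊔ Uᗮ : Submodule ℝ (Euc n)) ≤ n :=
    (Submodule.finrank_le _).trans hn.le
  have h4 : 0 < Module.finrank ℝ (W ⊓ Uᗮ : Submodule ℝ (Euc n)) := by omega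
  have h5 : (W ⊓ Uᗮ : Submodule ℝ (Euc n)) ≠ ⊥ := by
    intro h; rw [h, finrank_bot] at h4; omega
  obtain ⟨w, hw, hw0⟩ := Submodule.exists_mem_ne_zero_of_ne_bot h5
  have hwW : (‖w‖⁻¹ • w) ∈ W := W.smul_mem _ hw.1
  have hwn : ‖(‖w‖⁻¹ • w)‖ = 1 := by
    rw [norm_smul, norm_inv, norm_norm, inv_mul_cancel₀ (norm_ne_zero_iff.2 hw0)]
  let v : Fin (m + 1) → W := fun _ => ⟨_, hwW⟩
  have hv : Orthonormal ℝ (({0} : Set (Fin (m + 1))).domRestrict v) := by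
    constructor
    · intro i; exact hwn
    · intro i j hij
      exact absurd (Subsingleton.elim i j) hij
  obtain ⟨b, hb⟩ := hv.exists_orthonormalBasis_extension_of_card_eq (by simp [hWf'])
  refine ⟨fun i => (b i : Euc n), ?_, ?_, ?_⟩
  · exact b.orthonormal.comp_linearIsometry W.subtypeₗᵢ
  · intro z hz
    have : (b 0 : Euc n) = ‖w‖⁻¹ • w := by rw [hb 0 rfl]
    change inner ℝ (b 0 : Euc n) z = 0
    rw [this, inner_smul_left, Submodule.inner_left_of_mem_orthogonal hz hw.2, mul_zero]
  · intro z hz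
    have h := b.sum_repr' ⟨z, hW hz⟩
    have h' := congrArg (Subtype.val) h
    simp only [Submodule.coe_sum, Submodule.coe_smul, Submodule.coe_inner] at h'
    exact h'.symm

lemma aux_diam_le {n m : ℕ} (x : Fin (m + 2) → Euc n) (i j : Fin (m + 2)) :
    dist (x i) (x j) ≤ Metric.diam (Set.range x) :=
  Metric.dist_le_diam_of_mem (Set.finite_range x).isBounded ⟨i, rfl⟩ ⟨j, rfl⟩

/-- Volume of a simplex near an `m`-plane. -/
lemma aux_vol {n m : ℕ} (hmn : m < n) (x : Fin (m + 2) → Euc n)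
    (L : AffineSubspace ℝ (Euc n)) (hL : L ∈ affPlanes n m) :
    μH[(m + 1 : ℝ)] (convexHull ℝ (Set.range x)) ≤
      (m + 1 : ℝ≥0∞) ^ (m + 1) * ENNReal.ofReal
        ((4 * ∑ i, infDist (x i) (L : Set (Euc n))) *
          (2 * Metric.diam (Set.range x)) ^ m) := by
  obtain ⟨⟨l, hl⟩, hdim⟩ := hL
  set S := ∑ i, infDist (x i) (L : Set (Euc n)) with hS
  set d := Metric.diam (Set.range x) with hd
  have hd0 : 0 ≤ d := Metric.diam_nonneg
  have hS0 : 0 ≤ S := Finset.sum_nonneg fun i _ => infDist_nonneg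
  obtain ⟨b, hbo, hb0, hbs⟩ := aux_frame hmn L.direction hdim
    (fun i : Fin (m + 1) => x i.succ - x 0)
  -- bounds at vertices
  have hinf : ∀ i, infDist (x i) (L : Set (Euc n)) ≤ S := fun i =>
    Finset.single_le_sum (f := fun i => infDist (x i) (L : Set (Euc n)))
      (fun i _ => infDist_nonneg) (Finset.mem_univ i)
  have hproj : ∀ y : Euc n, |inner ℝ (b 0) (y - l)| ≤ infDist y (L : Set (Euc n)) := by
    intro y
    refine (le_infDist ⟨l, hl⟩).2 ?_
    intro z hz
    have h1 : inner ℝ (b 0) (z - l) = 0 := hb0 _ (by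
      simpa using AffineSubspace.vsub_mem_direction hz hl)
    have h2 : inner ℝ (b 0) (y - l) = inner ℝ (b 0) (y - z) := by
      rw [show y - l = (y - z) + (z - l) by abel, inner_add_right, h1, add_zero]
    rw [h2, dist_eq_norm]
    refine (abs_real_inner_le_norm _ _).trans ?_
    rw [hbo.1 0, one_mul]
  let lo : Fin (m + 1) → ℝ := Fin.cons (-(2 * S)) (fun _ => -d)
  let hi : Fin (m + 1) → ℝ := Fin.cons (2 * S) (fun _ => d)
  let T : (Fin (m + 1) → ℝ) →ₗ[ℝ] Euc n := Fintype.linearCombination ℝ b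
  let F : (Fin (m + 1) → ℝ) → Euc n := fun t => x 0 + T t
  have hT : ∀ t, T t = ∑ i, t i • b i := fun t => Fintype.linearCombination_apply ℝ b t
  have hconv : Convex ℝ (F '' Set.Icc lo hi) := by
    have : F '' Set.Icc lo hi = (fun z => x 0 + z) '' (T '' Set.Icc lo hi) := by
      rw [Set.image_image]
    rw [this]
    exact ((convex_Icc lo hi).linear_image T).translate _
  have hsub : convexHull ℝ (Set.range x) ⊆ F '' Set.Icc lo hi := by
    refine convexHull_min ?_ hconv
    rintro _ ⟨j, rfl⟩
    have hmem : x j - x 0 ∈ Submodule.span ℝ (Set.range fun i : Fin (m + 1) => x i.succ - x 0) := by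
      refine Fin.cases ?_ (fun i => ?_) j
      · simp
      · exact Submodule.subset_span ⟨i, rfl⟩
    refine ⟨fun i => inner ℝ (b i) (x j - x 0), ?_, ?_⟩
    · have key0 : |inner ℝ (b 0) (x j - x 0)| ≤ 2 * S := by
        rw [show x j - x 0 = (x j - l) - (x 0 - l) by abel, inner_sub_right]
        refine (abs_sub _ _).trans ?_
        linarith [hproj (x j), hproj (x 0), hinf j, hinf 0]
      have key : ∀ i, |inner ℝ (b i) (x j - x 0)| ≤ d := by
        intro i
        refine (abs_real_inner_le_norm _ _).trans ?_
        rw [hbo.1 i, one_mul, ← dist_eq_norm]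
        exact aux_diam_le x j 0
      constructor
      · intro i
        refine Fin.cases ?_ (fun i => ?_) i
        · exact (abs_le.1 key0).1
        · exact (abs_le.1 (key i.succ)).1
      · intro i
        refine Fin.cases ?_ (fun i => ?_) i
        · exact (abs_le.1 key0).2
        · exact (abs_le.1 (key i.succ)).2
    · change x 0 + T _ = x j
      rw [hT, ← hbs _ hmem]
      abel
  have hLip : LipschitzWith (m + 1 : ℝ≥0) F := by
    refine LipschitzWith.of_dist_le_mul fun s t => ?_
    have : F s - F t = ∑ i, (s i - t i) • b i := by
      simp only [F, hT, sub_smul, Finset.sum_sub_distrib]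
      abel
    rw [dist_eq_norm, this]
    refine (norm_sum_le _ _).trans ?_
    calc ∑ i, ‖(s i - t i) • b i‖ ≤ ∑ _i : Fin (m + 1), dist s t := by
          refine Finset.sum_le_sum fun i _ => ?_
          rw [norm_smul, hbo.1 i, mul_one, ← dist_eq_norm]
          exact dist_le_pi_dist s t i
      _ = _ := by simp
  calc μH[(m + 1 : ℝ)] (convexHull ℝ (Set.range x)) ≤ μH[(m + 1 : ℝ)] (F '' Set.Icc lo hi) :=
        measure_mono hsub
    _ ≤ ((m + 1 : ℝ≥0) : ℝ≥0∞) ^ (m + 1 : ℝ) * μH[(m + 1 : ℝ)] (Set.Icc lo hi) :=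
        hLip.hausdorffMeasure_image_le (by positivity) _
    _ = _ := by
        have h1 : (μH[(m + 1 : ℝ)] : Measure (Fin (m + 1) → ℝ)) = volume := by
          have := hausdorffMeasure_pi_real (ι := Fin (m + 1))
          simpa using this
        rw [h1, Real.volume_Icc_pi, Fin.prod_univ_succ]
        congr 1
        · rw [show (m + 1 : ℝ) = ((m + 1 : ℕ) : ℝ) by push_cast; rfl, ENNReal.rpow_natCast]
          push_cast; rfl
        · simp only [lo, hi, Fin.cons_zero, Fin.cons_succ, Finset.prod_const, Finset.card_univ,
            Fintype.card_fin]
          rw [← ENNReal.ofReal_pow (by linarith), ← ENNReal.ofReal_mul (by linarith)]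
          congr 1
          ring

/-- The constant in the pointwise estimate. -/
def auxC (m : ℕ) (p : ℝ) : ℝ≥0∞ :=
  ((m + 1 : ℝ≥0∞) ^ (m + 1) * ENNReal.ofReal (4 * 2 ^ m)) ^ p *
    ENNReal.ofReal ((m + 2 : ℝ) ^ (p - 1))

lemma auxC_ne_top (m : ℕ) (p : ℝ) (hp : 0 ≤ p) : auxC m p ≠ ∞ := by
  unfold auxC
  refine ENNReal.mul_ne_top (ENNReal.rpow_ne_top_of_nonneg hp ?_) ENNReal.ofReal_ne_top
  refine ENNReal.mul_ne_top (ENNReal.pow_ne_top ?_) ENNReal.ofReal_ne_top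
  exact_mod_cast ENNReal.natCast_ne_top (m + 1)

/-- The pointwise estimate of the curvature integrand. -/
lemma aux_pointwise {n m : ℕ} (hmn : m < n) (p : ℝ) (hp : 1 ≤ p) (x : Fin (m + 2) → Euc n)
    (L : AffineSubspace ℝ (Euc n)) (hL : L ∈ affPlanes n m) (r : ℝ) (hr : 0 < r)
    (hd : r < Metric.diam (Set.range x)) :
    kappa x ^ p / ENNReal.ofReal (Metric.diam (Set.range x) ^ p) ≤
      auxC m p * ENNReal.ofReal (r ^ (-(2 * p))) *
        ∑ i, ENNReal.ofReal (infDist (x i) (L : Set (Euc n)) ^ p) := by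
  have hv := aux_vol hmn x L hL
  set S := ∑ i, infDist (x i) (L : Set (Euc n)) with hS
  set d := Metric.diam (Set.range x) with hd'
  have hd0 : 0 < d := hr.trans hd
  have hS0 : 0 ≤ S := Finset.sum_nonneg fun i _ => infDist_nonneg
  have hk : kappa x ≤ (m + 1 : ℝ≥0∞) ^ (m + 1) * ENNReal.ofReal (4 * 2 ^ m) *
      ENNReal.ofReal (S / d) := by
    unfold kappa
    refine (ENNReal.div_le_div_right hv _).trans (le_of_eq ?_)
    rw [mul_div_assoc, ← ENNReal.ofReal_div_of_pos (by positivity),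
      mul_assoc ((m + 1 : ℝ≥0∞) ^ (m + 1)),
      ← ENNReal.ofReal_mul (p := 4 * 2 ^ m) (by positivity)]
    congr 2
    rw [← hd', mul_pow]
    field_simp
    ring
  have hSp : S ^ p ≤ (m + 2 : ℝ) ^ (p - 1) * ∑ i, infDist (x i) (L : Set (Euc n)) ^ p := by
    have := Real.rpow_sum_le_const_mul_sum_rpow (s := Finset.univ)
      (f := fun i => infDist (x i) (L : Set (Euc n))) hp
    simpa [abs_of_nonneg infDist_nonneg] using this
  have hreal : (S / d) ^ p / d ^ p ≤ (m + 2 : ℝ) ^ (p - 1) * (r ^ (-(2 * p)) *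
      ∑ i, infDist (x i) (L : Set (Euc n)) ^ p) := by
    have h1 : (S / d) ^ p / d ^ p = S ^ p * d ^ (-(2 * p)) := by
      rw [Real.div_rpow hS0 hd0.le, Real.rpow_neg hd0.le, two_mul, Real.rpow_add hd0]
      field_simp
    have h2 : d ^ (-(2 * p)) ≤ r ^ (-(2 * p)) :=
      Real.rpow_le_rpow_of_nonpos hr hd.le (by linarith)
    rw [h1]
    calc S ^ p * d ^ (-(2 * p)) ≤ ((m + 2 : ℝ) ^ (p - 1) *
          ∑ i, infDist (x i) (L : Set (Euc n)) ^ p) * r ^ (-(2 * p)) := by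
          gcongr
          exact mul_nonneg (by positivity)
            (Finset.sum_nonneg fun i _ => Real.rpow_nonneg infDist_nonneg _)
      _ = _ := by ring
  have hp0 : 0 ≤ p := by linarith
  calc kappa x ^ p / ENNReal.ofReal (d ^ p)
      ≤ ((m + 1 : ℝ≥0∞) ^ (m + 1) * ENNReal.ofReal (4 * 2 ^ m) *
        ENNReal.ofReal (S / d)) ^ p / ENNReal.ofReal (d ^ p) := by gcongr
    _ = ((m + 1 : ℝ≥0∞) ^ (m + 1) * ENNReal.ofReal (4 * 2 ^ m)) ^ p *
        ENNReal.ofReal ((S / d) ^ p / d ^ p) := by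
        rw [ENNReal.mul_rpow_of_nonneg _ _ hp0, mul_div_assoc,
          ENNReal.ofReal_rpow_of_nonneg (by positivity) hp0,
          ENNReal.ofReal_div_of_pos (by positivity)]
    _ ≤ ((m + 1 : ℝ≥0∞) ^ (m + 1) * ENNReal.ofReal (4 * 2 ^ m)) ^ p *
        ENNReal.ofReal ((m + 2 : ℝ) ^ (p - 1) * (r ^ (-(2 * p)) *
          ∑ i, infDist (x i) (L : Set (Euc n)) ^ p)) := by gcongr
    _ = _ := by
        rw [ENNReal.ofReal_mul (p := (m + 2 : ℝ) ^ (p - 1)) (by positivity),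
          ENNReal.ofReal_mul (p := r ^ (-(2 * p))) (by positivity),
          ENNReal.ofReal_sum_of_nonneg (fun i _ => Real.rpow_nonneg infDist_nonneg _)]
        unfold auxC
        ring

/-- Tuples of diameter zero do not contribute. -/
lemma aux_diam_zero {n m : ℕ} (p : ℝ) (hp : 1 ≤ p) (x : Fin (m + 2) → Euc n)
    (hd : Metric.diam (Set.range x) = 0) :
    kappa x ^ p / ENNReal.ofReal (Metric.diam (Set.range x) ^ p) = 0 := by
  have h0 : ∀ i, x i = x 0 := fun i => dist_le_zero.1 (hd ▸ aux_diam_le x i 0)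
  have hr : Set.range x = {x 0} := by
    ext y
    constructor
    · rintro ⟨i, rfl⟩; exact h0 i
    · rintro rfl; exact ⟨0, rfl⟩
  have hk : kappa x = 0 := by
    unfold kappa
    have := Measure.nullSingletonClass_hausdorff (Euc n) (d := (m + 1 : ℝ)) (by positivity)
    rw [hr, convexHull_singleton, measure_singleton, ENNReal.zero_div]
  rw [hk, ENNReal.zero_rpow_of_pos (by linarith), ENNReal.zero_div]

/-- Best approximation functional on a set. -/
def auxJ {n : ℕ} (μ : Measure (Euc n)) (m : ℕ) (p : ℝ) (B : Set (Euc n)) : ℝ≥0∞ :=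
  ⨅ L : affPlanes n m, ∫⁻ y in B, ENNReal.ofReal (infDist y (L.1 : Set (Euc n)) ^ p) ∂μ

lemma affPlanes_nonempty {n m : ℕ} (hmn : m < n) : Nonempty (affPlanes n m) := by
  obtain ⟨W, -, hW⟩ := aux_extend (⊥ : Submodule ℝ (Euc n)) m (by simp; omega)
  refine ⟨⟨W.toAffineSubspace, ⟨0, ?_⟩, ?_⟩⟩
  · exact W.zero_mem
  · rw [Submodule.toAffineSubspace_direction]
    simpa using hW

lemma auxJ_mono {n : ℕ} (μ : Measure (Euc n)) (m : ℕ) (p : ℝ) {B B' : Set (Euc n)}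
    (h : B ⊆ B') : auxJ μ m p B ≤ auxJ μ m p B' :=
  iInf_mono fun _ => lintegral_mono_set h

lemma aux_meas {n : ℕ} (p : ℝ) (hp : 1 ≤ p) (L : Set (Euc n)) :
    Measurable fun y => ENNReal.ofReal (infDist y L ^ p) := by
  have : Continuous fun y => ENNReal.ofReal (infDist y L ^ p) :=
    ENNReal.continuous_ofReal.comp
      ((continuous_infDist_pt L).rpow_const fun _ => Or.inr (by linarith))
  exact this.measurable

/-- Contribution of a box at a given scale. -/
lemma aux_box {n m : ℕ} (hmn : m < n) (p : ℝ) (hp : 1 ≤ p) (μ : Measure (Euc n))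
    [IsLocallyFiniteMeasure μ] (B : Set (Euc n)) (hB : MeasurableSet B) (hBf : μ B ≠ ∞)
    (r : ℝ) (hr : 0 < r) (S : Set (Fin (m + 2) → Euc n))
    (hS : ∀ x ∈ S, (∀ i, x i ∈ B) ∧ r < Metric.diam (Set.range x)) :
    ∫⁻ x in S, kappa x ^ p / ENNReal.ofReal (Metric.diam (Set.range x) ^ p)
      ∂(Measure.pi fun _ : Fin (m + 2) => μ) ≤
    auxC m p * ENNReal.ofReal (r ^ (-(2 * p))) * ((m + 2 : ℝ≥0∞) * μ B ^ (m + 1)) *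
      auxJ μ m p B := by
  have hne : auxC m p * ENNReal.ofReal (r ^ (-(2 * p))) * ((m + 2 : ℝ≥0∞) * μ B ^ (m + 1)) ≠ ∞ := by
    refine ENNReal.mul_ne_top (ENNReal.mul_ne_top (auxC_ne_top _ _ (by linarith))
      ENNReal.ofReal_ne_top) (ENNReal.mul_ne_top ?_ (ENNReal.pow_ne_top hBf))
    exact_mod_cast ENNReal.natCast_ne_top (m + 2)
  unfold auxJ
  have := affPlanes_nonempty hmn
  rw [ENNReal.mul_iInf (fun h => absurd h hne)]
  refine le_iInf fun L => ?_
  obtain ⟨L, hL⟩ := L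
  have hm0 := aux_meas p hp (L : Set (Euc n))
  set g : Euc n → ℝ≥0∞ := fun y => ENNReal.ofReal (infDist y (L : Set (Euc n)) ^ p) with hg
  set c := auxC m p * ENNReal.ofReal (r ^ (-(2 * p))) with hc
  have hsub : S ⊆ Set.univ.pi (fun _ => B) := fun x hx i _ => (hS x hx).1 i
  have hmG : Measurable fun x : Fin (m + 2) → Euc n => ∑ i, g (x i) :=
    Finset.measurable_sum _ fun i _ => hm0.comp (measurable_pi_apply i)
  have hfin : IsFiniteMeasure (μ.restrict B) := ⟨by simpa using hBf.lt_top⟩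
  have hone : ∀ i : Fin (m + 2), ∫⁻ x : Fin (m + 2) → Euc n, g (x i)
      ∂(Measure.pi fun _ : Fin (m + 2) => μ.restrict B) = μ B ^ (m + 1) * ∫⁻ y in B, g y ∂μ := by
    intro i
    have h1 := Measure.pi_map_eval (μ := fun _ : Fin (m + 2) => μ.restrict B) i
    have h2 : ∫⁻ y, g y ∂((Measure.pi fun _ : Fin (m + 2) => μ.restrict B).map (Function.eval i)) =
      ∫⁻ x : Fin (m + 2) → Euc n, g (x i) ∂(Measure.pi fun _ : Fin (m + 2) => μ.restrict B) :=
      lintegral_map hm0 (measurable_pi_apply i)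
    rw [← h2, h1, lintegral_smul_measure]
    simp [Finset.card_erase_of_mem]
  calc ∫⁻ x in S, kappa x ^ p / ENNReal.ofReal (Metric.diam (Set.range x) ^ p)
        ∂(Measure.pi fun _ : Fin (m + 2) => μ)
      ≤ ∫⁻ x in S, c * ∑ i, g (x i) ∂(Measure.pi fun _ : Fin (m + 2) => μ) :=
        setLIntegral_mono (hmG.const_mul c)
          fun x hx => aux_pointwise hmn p hp x L hL r hr (hS x hx).2
    _ ≤ ∫⁻ x in Set.univ.pi (fun _ => B), c * ∑ i, g (x i)
        ∂(Measure.pi fun _ : Fin (m + 2) => μ) := lintegral_mono_set hsub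
    _ = c * ∑ i : Fin (m + 2), (μ B ^ (m + 1) * ∫⁻ y in B, g y ∂μ) := by
        rw [Measure.restrict_pi_pi, lintegral_const_mul _ hmG, lintegral_finsetSum (f := fun
          (i : Fin (m + 2)) (x : Fin (m + 2) → Euc n) => g (x i)) _
          fun i _ => hm0.comp (measurable_pi_apply i)]
        congr 1
        exact Finset.sum_congr rfl fun i _ => hone i
    _ = _ := by
        rw [Finset.sum_const, Finset.card_univ, Fintype.card_fin, nsmul_eq_mul]
        push_cast
        ring

/-- Grid boxes. -/
def auxBox {n : ℕ} (r : ℝ) (a : Fin n → ℤ) : Set (Euc n) :=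
  {y | ∀ i, |⌊y i / r⌋ - a i| ≤ 2}

lemma auxBox_meas {n : ℕ} (r : ℝ) (a : Fin n → ℤ) : MeasurableSet (auxBox r a) := by
  have : auxBox r a = ⋂ i, (fun y : Euc n => ⌊y i / r⌋) ⁻¹' {z | |z - a i| ≤ 2} := by
    ext y; simp [auxBox]
  rw [this]
  refine MeasurableSet.iInter fun i => ?_
  have hm : Measurable fun y : Euc n => ⌊y i / r⌋ := by
    have h0 : Continuous fun y : Euc n => y i := by fun_prop
    exact Int.measurable_floor.comp (h0.measurable.div_const r)
  exact hm (MeasurableSet.of_discrete)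

lemma auxBox_subset {n : ℕ} (hn : 0 < n) (r : ℝ) (hr : 0 < r) (a : Fin n → ℤ) (x : Euc n)
    (hx : x ∈ auxBox r a) : auxBox r a ⊆ closedBall x (5 * n * r) := by
  intro y hy
  have hn1 : (1 : ℝ) ≤ n := by exact_mod_cast hn
  have hc : ∀ i, |y i - x i| ≤ 5 * r := by
    intro i
    have h1 := abs_le.1 (hx i)
    have h2 := abs_le.1 (hy i)
    have e1 := Int.floor_le (x i / r)
    have e2 := Int.lt_floor_add_one (x i / r)
    have e3 := Int.floor_le (y i / r)
    have e4 := Int.lt_floor_add_one (y i / r)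
    have f1 : (⌊y i / r⌋ : ℝ) ≤ ⌊x i / r⌋ + 4 := by
      have : ⌊y i / r⌋ ≤ ⌊x i / r⌋ + 4 := by omega
      exact_mod_cast this
    have f2 : (⌊x i / r⌋ : ℝ) ≤ ⌊y i / r⌋ + 4 := by
      have : ⌊x i / r⌋ ≤ ⌊y i / r⌋ + 4 := by omega
      exact_mod_cast this
    have hd : |y i / r - x i / r| ≤ 5 := abs_le.2 ⟨by linarith, by linarith⟩
    rw [← sub_div, abs_div, abs_of_pos hr, div_le_iff₀ hr] at hd
    exact hd
  rw [mem_closedBall, EuclideanSpace.dist_eq]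
  refine Real.sqrt_le_iff.2 ⟨by positivity, ?_⟩
  calc ∑ i, dist (y i) (x i) ^ 2 ≤ ∑ _i : Fin n, (5 * r) ^ 2 := by
        refine Finset.sum_le_sum fun i _ => ?_
        rw [Real.dist_eq]
        exact pow_le_pow_left₀ (abs_nonneg _) (hc i) 2
    _ = n * (5 * r) ^ 2 := by simp
    _ ≤ (5 * n * r) ^ 2 := by
        have h1 : (n : ℝ) ≤ n ^ 2 := by nlinarith
        calc (n : ℝ) * (5 * r) ^ 2 ≤ n ^ 2 * (5 * r) ^ 2 := by gcongr
          _ = (5 * n * r) ^ 2 := by ring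

lemma auxBox_cover {n : ℕ} (r : ℝ) (hr : 0 < r) (x y : Euc n) (h : dist y x ≤ 2 * r) :
    y ∈ auxBox r (fun i => ⌊x i / r⌋) := by
  intro i
  have h1 : |y i - x i| ≤ 2 * r := by
    have := PiLp.norm_apply_le (y - x) i
    rw [← dist_eq_norm] at this
    exact this.trans h
  have h2 : |y i / r - x i / r| ≤ 2 := by
    rwa [← sub_div, abs_div, abs_of_pos hr, div_le_iff₀ hr]
  have h3 := abs_le.1 h2
  have g1 : ⌊y i / r⌋ ≤ ⌊x i / r⌋ + 2 := by
    have := Int.floor_le_floor (show y i / r ≤ x i / r + (2 : ℤ) by push_cast; linarith)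
    rwa [Int.floor_add_intCast] at this
  have g2 : ⌊x i / r⌋ ≤ ⌊y i / r⌋ + 2 := by
    have := Int.floor_le_floor (show x i / r ≤ y i / r + (2 : ℤ) by push_cast; linarith)
    rwa [Int.floor_add_intCast] at this
  change |⌊y i / r⌋ - ⌊x i / r⌋| ≤ 2
  exact abs_le.2 ⟨by omega, by omega⟩

lemma auxBox_overlap {n : ℕ} (r : ℝ) (x : Euc n) (J : (Fin n → ℤ) → ℝ≥0∞) (G : ℝ≥0∞)
    (hJ : ∀ a, x ∈ auxBox r a → J a ≤ G) :
    ∑' a, (auxBox r a).indicator (fun _ => J a) x ≤ 5 ^ n * G := by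
  classical
  let φ : Fin n → ℤ := fun i => ⌊x i / r⌋
  have hmem : ∀ a, x ∈ auxBox r a → a ∈ Finset.Icc (fun i => φ i - 2) (fun i => φ i + 2) := by
    intro a ha
    rw [Finset.mem_Icc]
    constructor <;> intro i <;> have := abs_le.1 (ha i) <;> simp only [φ] <;> omega
  rw [tsum_eq_sum (s := Finset.Icc (fun i => φ i - 2) (fun i => φ i + 2))
    (fun a ha => Set.indicator_of_notMem (fun h => ha (hmem a h)) _)]
  calc ∑ a ∈ Finset.Icc (fun i => φ i - 2) (fun i => φ i + 2),
        (auxBox r a).indicator (fun _ => J a) x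
      ≤ ∑ _a ∈ Finset.Icc (fun i => φ i - 2) (fun i => φ i + 2), G := by
        refine Finset.sum_le_sum fun a _ => ?_
        by_cases h : x ∈ auxBox r a
        · rw [Set.indicator_of_mem h]; exact hJ a h
        · rw [Set.indicator_of_notMem h]; exact bot_le
    _ = 5 ^ n * G := by
        rw [Finset.sum_const, nsmul_eq_mul, Pi.card_Icc]
        congr 1
        have : ∀ i, (Finset.Icc (φ i - 2) (φ i + 2)).card = 5 := by
          intro i; rw [Int.card_Icc]; omega
        simp [this]

/-- The radial lower bound on one dyadic shell. -/
lemma aux_radial {n m : ℕ} (p : ℝ) (hp1 : 1 ≤ p) (hp : (m * (m + 1) : ℝ) ≤ p)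
    (μ : Measure (Euc n)) (x : Euc n) (ρ : ℝ) (hρ : 0 < ρ) :
    ENNReal.ofReal (ρ * (2 * ρ) ^ ((m * m : ℝ) - 2 * p - 1)) * auxJ μ m p (closedBall x ρ) ≤
      ∫⁻ r in Set.Ico ρ (2 * ρ),
        ENNReal.ofReal (r ^ ((m * (m + 1) : ℝ) - p)) * betaInf μ m p x r ^ p *
              ENNReal.ofReal (1 / r) := by
  have hp0 : 0 < p := by linarith
  have hpt : ∀ r ∈ Set.Ico ρ (2 * ρ),
      ENNReal.ofReal ((2 * ρ) ^ ((m * m : ℝ) - 2 * p - 1)) * auxJ μ m p (closedBall x ρ) ≤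
        ENNReal.ofReal (r ^ ((m * (m + 1) : ℝ) - p)) * betaInf μ m p x r ^ p *
              ENNReal.ofReal (1 / r) := by
    intro r hr
    have hr0 : 0 < r := hρ.trans_le hr.1
    have hb : (ENNReal.ofReal r)⁻¹ * ((ENNReal.ofReal r ^ m)⁻¹ *
        auxJ μ m p (closedBall x ρ)) ^ (1 / p) ≤ betaInf μ m p x r := by
      unfold betaInf
      refine le_iInf₂ fun L hL => ?_
      unfold betaL
      gcongr
      exact (auxJ_mono μ m p (closedBall_subset_closedBall hr.1)).trans
        (iInf_le _ (⟨L, hL⟩ : affPlanes n m))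
    have hb2 : ENNReal.ofReal (r ^ (-p - m)) * auxJ μ m p (closedBall x ρ) ≤
        betaInf μ m p x r ^ p := by
      refine le_trans (le_of_eq ?_) (ENNReal.rpow_le_rpow hb hp0.le)
      rw [ENNReal.mul_rpow_of_nonneg _ _ hp0.le, ← ENNReal.rpow_mul,
        one_div_mul_cancel hp0.ne', ENNReal.rpow_one, ← mul_assoc,
        ← ENNReal.ofReal_pow hr0.le, ← ENNReal.ofReal_inv_of_pos hr0,
        ← ENNReal.ofReal_inv_of_pos (by positivity),
        ENNReal.ofReal_rpow_of_nonneg (by positivity) hp0.le,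
        ← ENNReal.ofReal_mul (by positivity)]
      congr 2
      rw [Real.rpow_sub hr0, Real.rpow_neg hr0.le, Real.inv_rpow hr0.le, Real.rpow_natCast]
      rfl
    have he : (2 * ρ) ^ ((m * m : ℝ) - 2 * p - 1) ≤
        r ^ ((m * (m + 1) : ℝ) - p) * r ^ (-p - m) * (1 / r) := by
      have h1 : r ^ ((m * (m + 1) : ℝ) - p) * r ^ (-p - m) * (1 / r) =
          r ^ ((m * m : ℝ) - 2 * p - 1) := by
        rw [← Real.rpow_add hr0, Real.rpow_sub_one hr0.ne', mul_one_div]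
        congr 2
        ring
      rw [h1]
      have hm0 : (0 : ℝ) ≤ m := by positivity
      exact Real.rpow_le_rpow_of_nonpos hr0 hr.2.le (by nlinarith)
    calc ENNReal.ofReal ((2 * ρ) ^ ((m * m : ℝ) - 2 * p - 1)) * auxJ μ m p (closedBall x ρ)
        ≤ ENNReal.ofReal (r ^ ((m * (m + 1) : ℝ) - p) * r ^ (-p - m) * (1 / r)) *
          auxJ μ m p (closedBall x ρ) := by gcongr
      _ = ENNReal.ofReal (r ^ ((m * (m + 1) : ℝ) - p)) *
          (ENNReal.ofReal (r ^ (-p - m)) * auxJ μ m p (closedBall x ρ)) *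
              ENNReal.ofReal (1 / r) := by
          rw [ENNReal.ofReal_mul (by positivity), ENNReal.ofReal_mul (by positivity)]
          ring
      _ ≤ _ := by gcongr
  calc _ = ∫⁻ _r in Set.Ico ρ (2 * ρ),
        ENNReal.ofReal ((2 * ρ) ^ ((m * m : ℝ) - 2 * p - 1)) * auxJ μ m p (closedBall x ρ) := by
        rw [setLIntegral_const, Real.volume_Ico, ENNReal.ofReal_mul hρ.le,
          show 2 * ρ - ρ = ρ by ring]
        ring
    _ ≤ _ := setLIntegral_mono' measurableSet_Ico hpt

lemma aux_shells (c : ℝ) (hc : 0 < c) (F : ℝ → ℝ≥0∞) :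
    ∑' k : ℤ, ∫⁻ r in Set.Ico (c * 2 ^ k) (2 * (c * 2 ^ k)), F r ≤ ∫⁻ r in Set.Ioi (0 : ℝ), F r := by
  rw [← lintegral_iUnion (fun k => measurableSet_Ico)]
  · refine lintegral_mono_set ?_
    refine Set.iUnion_subset fun k r hr => ?_
    exact lt_of_lt_of_le (by positivity) hr.1
  · rw [pairwise_disjoint_on]
    intro k l hkl
    rw [Set.disjoint_left]
    intro r h1 h2
    have h3 : (2 : ℝ) ^ (k + 1) ≤ 2 ^ l := zpow_le_zpow_right₀ (by norm_num) (by omega)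
    rw [zpow_add_one₀ (by norm_num)] at h3
    have := h1.2
    have := h2.1
    nlinarith

/-- Remark (previous): for `p ≥ m(m+1)` and measures with `μ(B̄(x,r)) ≤ M ω_m r^m`,
`M_p(μ) ≤ Γ M^m ∫∫₀^∞ r^{m(m+1)−p} β_{μ,p}(x,r)^p dr/r dμ(x)`. -/
theorem stmt5 (n m : ℕ) (hm : 0 < m) (hmn : m < n) (p : ℝ) (hp : (m * (m + 1) : ℝ) ≤ p) :
    ∃ Γ : ℝ≥0∞, 0 < Γ ∧ Γ ≠ ∞ ∧
      ∀ (M : ℝ), 0 < M →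
      ∀ (μ : Measure (Euc n)) [IsLocallyFiniteMeasure μ],
        (∀ (x : Euc n) (r : ℝ), 0 < r →
          μ (closedBall x r) ≤ ENNReal.ofReal M * ballVol m * ENNReal.ofReal r ^ m) →
        Mp μ m p ≤ Γ * ENNReal.ofReal M ^ m *
          ∫⁻ x, (∫⁻ r in Set.Ioi (0 : ℝ),
            ENNReal.ofReal (r ^ ((m * (m + 1) : ℝ) - p)) * betaInf μ m p x r ^ p *
              ENNReal.ofReal (1 / r)) ∂μ := by
  have hn : 0 < n := hm.trans hmn
  have hm1 : (1 : ℝ) ≤ m := by exact_mod_cast hm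
  have hn0 : (0 : ℝ) < n := by exact_mod_cast hn
  have hp1 : 1 ≤ p := by nlinarith
  set c : ℝ := (5 * n : ℝ) ^ (2 * p) * 2 ^ (2 * p + 1 - (m * m : ℝ)) with hc
  set Γ₀ : ℝ≥0∞ := auxC m p * (m + 2 : ℝ≥0∞) * ballVol m ^ m * 5 ^ n * ENNReal.ofReal c with hΓ
  have hbv : ballVol m ≠ ∞ := measure_closedBall_lt_top.ne
  refine ⟨Γ₀ + 1, by positivity, ?_, ?_⟩
  · refine ENNReal.add_ne_top.2 ⟨?_, ENNReal.one_ne_top⟩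
    refine ENNReal.mul_ne_top (ENNReal.mul_ne_top (ENNReal.mul_ne_top (ENNReal.mul_ne_top
      (auxC_ne_top _ _ (by linarith)) ?_) (ENNReal.pow_ne_top hbv)) (ENNReal.pow_ne_top (by simp)))
      ENNReal.ofReal_ne_top
    exact_mod_cast ENNReal.natCast_ne_top (m + 2)
  intro M hM μ _ hμ
  set f : (Fin (m + 2) → Euc n) → ℝ≥0∞ := fun x =>
    kappa x ^ p / ENNReal.ofReal (Metric.diam (Set.range x) ^ p) with hf
  set π : Measure (Fin (m + 2) → Euc n) := Measure.pi fun _ : Fin (m + 2) => μ with hπ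
  let R : ℤ → ℝ := fun k => 2 ^ k
  let ρ : ℤ → ℝ := fun k => 5 * n * 2 ^ k
  have hR : ∀ k, 0 < R k := fun k => by positivity
  have hρ : ∀ k, 0 < ρ k := fun k => by positivity
  let S : ℤ × (Fin n → ℤ) → Set (Fin (m + 2) → Euc n) := fun q =>
    {x | (∀ i, x i ∈ auxBox (R q.1) q.2) ∧ R q.1 < Metric.diam (Set.range x)}
  let Z : Set (Fin (m + 2) → Euc n) := {x | Metric.diam (Set.range x) = 0}
  have hcover : (Set.univ : Set (Fin (m + 2) → Euc n)) ⊆ Z ∪ ⋃ q, S q := by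
    intro x _
    by_cases hx : Metric.diam (Set.range x) = 0
    · exact Or.inl hx
    · right
      have hpos : 0 < Metric.diam (Set.range x) := lt_of_le_of_ne Metric.diam_nonneg (Ne.symm hx)
      obtain ⟨k, hk1, hk2⟩ := exists_mem_Ioc_zpow hpos (one_lt_two : (1 : ℝ) < 2)
      refine Set.mem_iUnion.2 ⟨(k, fun i => ⌊x 0 i / R k⌋), ?_, hk1⟩
      intro i
      refine auxBox_cover (R k) (hR k) (x 0) (x i) ((aux_diam_le x i 0).trans (hk2.trans ?_))
      rw [zpow_add_one₀ (by norm_num), mul_comm]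
  let D : ℤ → ℝ≥0∞ := fun k => ENNReal.ofReal M * ballVol m * ENNReal.ofReal (ρ k) ^ m
  let E : ℤ → ℝ≥0∞ := fun k =>
    auxC m p * ENNReal.ofReal (R k ^ (-(2 * p))) * ((m + 2 : ℝ≥0∞) * D k ^ m)
  have hD : ∀ k a, μ (auxBox (R k) a) ≤ D k := by
    intro k a
    rcases (auxBox (R k) a).eq_empty_or_nonempty with h | ⟨x, hx⟩
    · rw [h, measure_empty]; exact bot_le
    · exact (measure_mono (auxBox_subset hn (R k) (hR k) a x hx)).trans (hμ x (ρ k) (hρ k))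
  have hDfin : ∀ k, D k ≠ ∞ := fun k => ENNReal.mul_ne_top
    (ENNReal.mul_ne_top ENNReal.ofReal_ne_top hbv) (ENNReal.pow_ne_top ENNReal.ofReal_ne_top)
  let g : ℤ × (Fin n → ℤ) → Euc n → ℝ≥0∞ := fun q x =>
    E q.1 * (auxBox (R q.1) q.2).indicator (fun _ => auxJ μ m p (auxBox (R q.1) q.2)) x
  have hgm : ∀ q, Measurable (g q) := fun q =>
    (measurable_const.indicator (auxBox_meas _ _)).const_mul _
  have hpiece : ∀ q, ∫⁻ x in S q, f x ∂π ≤ ∫⁻ x, g q x ∂μ := by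
    rintro ⟨k, a⟩
    refine (aux_box hmn p hp1 μ (auxBox (R k) a) (auxBox_meas _ _)
      (ne_top_of_le_ne_top (hDfin k) (hD k a)) (R k) (hR k) (S (k, a)) (fun x hx => hx)).trans ?_
    simp only [g]
    rw [lintegral_const_mul _ (measurable_const.indicator (auxBox_meas _ _)),
      lintegral_indicator_const (auxBox_meas _ _)]
    calc auxC m p * ENNReal.ofReal (R k ^ (-(2 * p))) *
          ((m + 2 : ℝ≥0∞) * μ (auxBox (R k) a) ^ (m + 1)) * auxJ μ m p (auxBox (R k) a)
        = auxC m p * ENNReal.ofReal (R k ^ (-(2 * p))) *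
          ((m + 2 : ℝ≥0∞) * μ (auxBox (R k) a) ^ m) *
            (auxJ μ m p (auxBox (R k) a) * μ (auxBox (R k) a)) := by ring
      _ ≤ _ := by
        simp only [E]
        gcongr
        exact hD k a
  have hconst : ∀ k, E k * 5 ^ n ≤ (Γ₀ + 1) * ENNReal.ofReal M ^ m *
      ENNReal.ofReal (ρ k * (2 * ρ k) ^ ((m * m : ℝ) - 2 * p - 1)) := by
    intro k
    have hreal : R k ^ (-(2 * p)) * (ρ k ^ m) ^ m =
        c * (ρ k * (2 * ρ k) ^ ((m * m : ℝ) - 2 * p - 1)) := by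
      have h5 : (0 : ℝ) < 5 * n := by positivity
      have h1 : ρ k = 5 * n * R k := rfl
      have h2 : (ρ k ^ m) ^ m = ρ k ^ (m * m : ℝ) := by
        rw [← pow_mul, ← Real.rpow_natCast]; push_cast; rfl
      have h3 : R k ^ (-(2 * p)) = (5 * n : ℝ) ^ (2 * p) * ρ k ^ (-(2 * p)) := by
        rw [h1, Real.mul_rpow h5.le (hR k).le, ← mul_assoc, ← Real.rpow_add h5, add_neg_cancel,
          Real.rpow_zero, one_mul]
      have h4 : ρ k * (2 * ρ k) ^ ((m * m : ℝ) - 2 * p - 1) =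
          2 ^ ((m * m : ℝ) - 2 * p - 1) * ρ k ^ ((m * m : ℝ) - 2 * p) := by
        rw [Real.mul_rpow (by norm_num) (hρ k).le, Real.rpow_sub_one (hρ k).ne' _]
        have := (hρ k).ne'
        field_simp
      have h6 : (2 : ℝ) ^ (2 * p + 1 - (m * m : ℝ)) * 2 ^ ((m * m : ℝ) - 2 * p - 1) = 1 := by
        rw [← Real.rpow_add (by norm_num)]
        ring_nf
        exact Real.rpow_zero 2
      rw [h4, h3, h2, hc, mul_assoc, ← Real.rpow_add (hρ k)]
      rw [show (5 * n : ℝ) ^ (2 * p) * 2 ^ (2 * p + 1 - (m * m : ℝ)) *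
        (2 ^ ((m * m : ℝ) - 2 * p - 1) * ρ k ^ ((m * m : ℝ) - 2 * p)) =
        (5 * n : ℝ) ^ (2 * p) * ((2 : ℝ) ^ (2 * p + 1 - (m * m : ℝ)) *
          2 ^ ((m * m : ℝ) - 2 * p - 1)) * ρ k ^ ((m * m : ℝ) - 2 * p) by ring, h6]
      rw [mul_one]
      congr 2
      ring
    have hE : ENNReal.ofReal (R k ^ (-(2 * p))) * (ENNReal.ofReal (ρ k) ^ m) ^ m =
        ENNReal.ofReal c * ENNReal.ofReal (ρ k * (2 * ρ k) ^ ((m * m : ℝ) - 2 * p - 1)) := by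
      rw [← ENNReal.ofReal_mul (by positivity), ← hreal,
        ENNReal.ofReal_mul (Real.rpow_nonneg (hR k).le _), ENNReal.ofReal_pow (pow_nonneg (hρ k).le _),
        ENNReal.ofReal_pow (hρ k).le]
    calc E k * 5 ^ n = auxC m p * (m + 2 : ℝ≥0∞) * ballVol m ^ m * 5 ^ n * ENNReal.ofReal M ^ m *
          (ENNReal.ofReal (R k ^ (-(2 * p))) * (ENNReal.ofReal (ρ k) ^ m) ^ m) := by
          simp only [E, D]; ring
      _ = Γ₀ * ENNReal.ofReal M ^ m *
          ENNReal.ofReal (ρ k * (2 * ρ k) ^ ((m * m : ℝ) - 2 * p - 1)) := by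
          rw [hE, hΓ]; ring
      _ ≤ _ := by
          gcongr
          exact le_self_add
  have hA : (Γ₀ + 1) * ENNReal.ofReal M ^ m ≠ ∞ := by
    refine ENNReal.mul_ne_top (ENNReal.add_ne_top.2 ⟨?_, ENNReal.one_ne_top⟩)
      (ENNReal.pow_ne_top ENNReal.ofReal_ne_top)
    refine ENNReal.mul_ne_top (ENNReal.mul_ne_top (ENNReal.mul_ne_top (ENNReal.mul_ne_top
      (auxC_ne_top _ _ (by linarith)) ?_) (ENNReal.pow_ne_top hbv)) (ENNReal.pow_ne_top (by simp)))
      ENNReal.ofReal_ne_top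
    exact_mod_cast ENNReal.natCast_ne_top (m + 2)
  have hpoint : ∀ x, ∑' q, g q x ≤ (Γ₀ + 1) * ENNReal.ofReal M ^ m *
      ∫⁻ r in Set.Ioi (0 : ℝ), ENNReal.ofReal (r ^ ((m * (m + 1) : ℝ) - p)) *
        betaInf μ m p x r ^ p * ENNReal.ofReal (1 / r) := by
    intro x
    rw [ENNReal.tsum_prod']
    calc ∑' k, ∑' a, g (k, a) x
        ≤ ∑' k, (Γ₀ + 1) * ENNReal.ofReal M ^ m * ∫⁻ r in Set.Ico (ρ k) (2 * ρ k),
          ENNReal.ofReal (r ^ ((m * (m + 1) : ℝ) - p)) *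
            betaInf μ m p x r ^ p * ENNReal.ofReal (1 / r) := by
          refine ENNReal.tsum_le_tsum fun k => ?_
          simp only [g]
          rw [ENNReal.tsum_mul_left]
          calc E k * ∑' a, (auxBox (R k) a).indicator (fun _ => auxJ μ m p (auxBox (R k) a)) x
              ≤ E k * (5 ^ n * auxJ μ m p (closedBall x (ρ k))) := by
                gcongr
                exact auxBox_overlap (R k) x _ _ fun a ha =>
                  auxJ_mono μ m p (auxBox_subset hn (R k) (hR k) a x ha)
            _ = (E k * 5 ^ n) * auxJ μ m p (closedBall x (ρ k)) := by ring
            _ ≤ ((Γ₀ + 1) * ENNReal.ofReal M ^ m *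
                ENNReal.ofReal (ρ k * (2 * ρ k) ^ ((m * m : ℝ) - 2 * p - 1))) *
                  auxJ μ m p (closedBall x (ρ k)) := by
                exact mul_le_mul_left (hconst k) _
            _ ≤ _ := by
                rw [mul_assoc ((Γ₀ + 1) * ENNReal.ofReal M ^ m)]
                gcongr
                exact aux_radial p hp1 hp μ x (ρ k) (hρ k)
      _ ≤ _ := by
          rw [ENNReal.tsum_mul_left]
          gcongr
          exact aux_shells (5 * n) (by positivity) _
  calc Mp μ m p = ∫⁻ x in Set.univ, f x ∂π := by rw [setLIntegral_univ]; rfl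
    _ ≤ ∫⁻ x in Z ∪ ⋃ q, S q, f x ∂π := lintegral_mono_set hcover
    _ ≤ ∫⁻ x in Z, f x ∂π + ∫⁻ x in ⋃ q, S q, f x ∂π := lintegral_union_le _ _ _
    _ ≤ 0 + ∑' q, ∫⁻ x in S q, f x ∂π := by
        refine add_le_add ?_ (lintegral_iUnion_le _ _)
        refine (setLIntegral_mono (g := fun _ => 0) measurable_const
          fun x hx => (aux_diam_zero p hp1 x hx).le).trans ?_
        simp
    _ ≤ ∑' q, ∫⁻ x, g q x ∂μ := by
        rw [zero_add]
        exact ENNReal.tsum_le_tsum hpiece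
    _ = ∫⁻ x, ∑' q, g q x ∂μ := (lintegral_tsum fun q => (hgm q).aemeasurable).symm
    _ ≤ ∫⁻ x, (Γ₀ + 1) * ENNReal.ofReal M ^ m *
        (∫⁻ r in Set.Ioi (0 : ℝ), ENNReal.ofReal (r ^ ((m * (m + 1) : ℝ) - p)) *
          betaInf μ m p x r ^ p * ENNReal.ofReal (1 / r)) ∂μ := lintegral_mono hpoint
    _ = _ := lintegral_const_mul' _ _ hA
end
end
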